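/- arXiv:2412.15096 — 2 statements merged into one kernel-verified Lean document; each statement's English description precedes it below -/
import Mathlib

section
/- Let Γ ⊂ P^n be a nondegenerate finite subscheme of degree d in linearly general position over an algebraically closed field of characteristic 0 with ⌈(d−1)/(n + n/(2n+2))⌉ + 3 ≤ reg(Γ), and let Q ⊂ P^n be a quadric hypersurface such that |Q ∩ Γ| ≥ 2n+1 and reg(Γ ∩ Q) < reg(Γ). Define nonnegative integers m and m' by reg(Γ) = ⌈(d−1)/n⌉ − m + 1 and reg(Γ : Q) = ⌈(|Γ : Q| − 1)/n⌉ − m' + 1. Then m ≥ m'. -/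
open MvPolynomial Filter
open scoped Classical

attribute [local instance] MvPolynomial.gradedAlgebra

noncomputable section

variable {K : Type} [Field K] {n : ℕ}

/-- The Hilbert function, in degree `m`, of the quotient of the homogeneous
coordinate ring of `ℙ^n_K` by the ideal `I`. -/
def hilbF (I : Ideal (MvPolynomial (Fin (n+1)) K)) (m : ℕ) : ℕ :=
  Module.finrank K
    ((MvPolynomial.homogeneousSubmodule (Fin (n+1)) K m).map
      (Ideal.Quotient.mkₐ K I).toLinearMap)

/-- The irrelevant maximal ideal `(x_0, …, x_n)`. -/
def irrelevantIdeal (K : Type) [Field K] (n : ℕ) : Ideal (MvPolynomial (Fin (n+1)) K) :=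
  Ideal.span (Set.range MvPolynomial.X)

/-- Saturation of a homogeneous ideal with respect to the irrelevant ideal. -/
def saturate (I : Ideal (MvPolynomial (Fin (n+1)) K)) : Ideal (MvPolynomial (Fin (n+1)) K) :=
  ⨆ k : ℕ, Submodule.colon I ((irrelevantIdeal K n ^ k : Ideal (MvPolynomial (Fin (n+1)) K)) : Submodule (MvPolynomial (Fin (n+1)) K) (MvPolynomial (Fin (n+1)) K))

/-- `I` is the (saturated, homogeneous) ideal of a nonempty finite closed subscheme of
`ℙ^n`, i.e. its Hilbert function is eventually a positive constant. -/
structure IsFiniteSubscheme (I : Ideal (MvPolynomial (Fin (n+1)) K)) : Prop where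
  homog : Ideal.IsHomogeneous (MvPolynomial.homogeneousSubmodule (Fin (n+1)) K) I
  saturated : saturate I = I
  finite : ∃ d : ℕ, 0 < d ∧ ∀ᶠ m : ℕ in atTop, hilbF I m = d

/-- The degree (length) of the finite scheme with ideal `I` : the eventual value of
its Hilbert function. -/
def schemeDeg (I : Ideal (MvPolynomial (Fin (n+1)) K)) : ℕ :=
  if h : ∃ d : ℕ, ∀ᶠ m : ℕ in atTop, hilbF I m = d then h.choose else 0

/-- The Castelnuovo–Mumford regularity of the finite scheme with ideal `I` : the least
`p ≥ 1` such that the scheme is `(p-1)`-normal (for a finite scheme, `p`-regularity is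
equivalent to `(p-1)`-normality). -/
def schemeReg (I : Ideal (MvPolynomial (Fin (n+1)) K)) : ℕ :=
  sInf {p : ℕ | 1 ≤ p ∧ ∀ m : ℕ, p - 1 ≤ m → hilbF I m = schemeDeg I}

/-- `h¹(ℙ^n, I_Γ(q))` for a finite scheme `Γ` and `q ≥ 0`: the failure of `q`-normality,
`deg Γ - h_Γ(q)`. -/
def h1F (I : Ideal (MvPolynomial (Fin (n+1)) K)) (q : ℕ) : ℕ :=
  schemeDeg I - hilbF I q

/-- `J` is the ideal of a `t`-dimensional linear subspace of `ℙ^n`: it is generated by a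
space of linear forms of codimension... i.e. of `K`-dimension `n - t`. -/
def IsLinearSubspace (J : Ideal (MvPolynomial (Fin (n+1)) K)) (t : ℕ) : Prop :=
  ∃ W : Submodule K (MvPolynomial (Fin (n+1)) K),
    W ≤ MvPolynomial.homogeneousSubmodule (Fin (n+1)) K 1 ∧
    Module.finrank K W + t = n ∧
    J = Ideal.span (W : Set (MvPolynomial (Fin (n+1)) K))

/-- The ideal of the scheme-theoretic intersection (defined by the sum of the ideal
sheaves): the saturation of `I + J`. -/
def interIdeal (I J : Ideal (MvPolynomial (Fin (n+1)) K)) : Ideal (MvPolynomial (Fin (n+1)) K) :=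
  saturate (I ⊔ J)

/-- The residual scheme `Γ : V`, where `V` is the hypersurface `{f = 0}`, is defined by
the colon ideal `(I_Γ : f)`. -/
def residualIdeal (I : Ideal (MvPolynomial (Fin (n+1)) K)) (f : MvPolynomial (Fin (n+1)) K) :
    Ideal (MvPolynomial (Fin (n+1)) K) :=
  Submodule.colon I (Ideal.span {f})

/-- `Γ` admits a `(t+2)`-secant `t`-plane. -/
def HasSecantPlane (I : Ideal (MvPolynomial (Fin (n+1)) K)) (t : ℕ) : Prop :=
  ∃ J : Ideal (MvPolynomial (Fin (n+1)) K),
    IsLinearSubspace J t ∧ t + 2 ≤ schemeDeg (interIdeal I J)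

/-- `t(Γ)`: the smallest `t` such that `Γ` admits a `(t+2)`-secant `t`-plane. -/
def tInv (I : Ideal (MvPolynomial (Fin (n+1)) K)) : ℕ :=
  sInf {t : ℕ | HasSecantPlane I t}

/-- `Γ` is in linearly general position if `t(Γ) = n`. -/
def InLinGenPos (I : Ideal (MvPolynomial (Fin (n+1)) K)) : Prop :=
  tInv I = n

/-- `Γ ⊆ ℙ^n` is nondegenerate: `I(Γ)` contains no nonzero linear form. -/
def NondegenerateScheme (I : Ideal (MvPolynomial (Fin (n+1)) K)) : Prop :=
  Submodule.restrictScalars K I ⊓ MvPolynomial.homogeneousSubmodule (Fin (n+1)) K 1 = ⊥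

/-- The (projective) dimension of the linear span `⟨Γ⟩` of the scheme with ideal `I`:
`n` minus the number of independent linear forms in `I`. -/
def spanDim (I : Ideal (MvPolynomial (Fin (n+1)) K)) : ℕ :=
  n - Module.finrank K
    ↥(Submodule.restrictScalars K I ⊓ MvPolynomial.homogeneousSubmodule (Fin (n+1)) K 1)

/-- `Γ ∩ Λ` is nondegenerate as a subscheme of the `t`-plane `Λ`: it is contained in no
`(t-1)`-dimensional linear subspace of `Λ`. -/
def NondegenerateIn (I Λ : Ideal (MvPolynomial (Fin (n+1)) K)) (t : ℕ) : Prop :=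
  ∀ J : Ideal (MvPolynomial (Fin (n+1)) K),
    IsLinearSubspace J (t - 1) → Λ ≤ J → ¬ J ≤ interIdeal I Λ

/-- `Γ ∩ Λ` is in linearly general position as a subscheme of the `t`-plane `Λ`: it has
no `(s+2)`-secant `s`-plane inside `Λ` for any `s < t`. -/
def InLinGenPosIn (I Λ : Ideal (MvPolynomial (Fin (n+1)) K)) (t : ℕ) : Prop :=
  ∀ s : ℕ, s < t → ∀ J : Ideal (MvPolynomial (Fin (n+1)) K),
    IsLinearSubspace J s → Λ ≤ J → schemeDeg (interIdeal I J) ≤ s + 1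

/-- `J` is the (saturated) homogeneous ideal of a rational normal curve of degree `t`
in `ℙ^n` : the curve is the image of `ℙ^1` under a parametrization by a basis-spanning
family of binary forms of degree `t`, and `J` is the vanishing ideal of (the affine cone
over) this image. -/
def IsRNC (t : ℕ) (J : Ideal (MvPolynomial (Fin (n+1)) K)) : Prop :=
  ∃ p : Fin (n+1) → MvPolynomial (Fin 2) K,
    (∀ i, (p i).IsHomogeneous t) ∧
    Submodule.span K (Set.range p) = MvPolynomial.homogeneousSubmodule (Fin 2) K t ∧
    J = ⨅ x : Fin 2 → K,
      RingHom.ker (MvPolynomial.eval (fun i => MvPolynomial.eval x (p i)) :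
        MvPolynomial (Fin (n+1)) K →+* K)

/-- `ρ(Γ)`: the maximal length of the intersection of `Γ` with a rational normal curve
(of degree `n`) in `ℙ^n`. -/
def rhoInv (I : Ideal (MvPolynomial (Fin (n+1)) K)) : ℕ :=
  sSup {e : ℕ | ∃ J : Ideal (MvPolynomial (Fin (n+1)) K),
    IsRNC n J ∧ e = schemeDeg (interIdeal I J)}

/-- The (saturated homogeneous) vanishing ideal of a point of `ℙ^n`. -/
def pointIdeal (P : Projectivization K (Fin (n+1) → K)) : Ideal (MvPolynomial (Fin (n+1)) K) :=
  ⨅ c : K, RingHom.ker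
    (MvPolynomial.eval (c • P.rep) : MvPolynomial (Fin (n+1)) K →+* K)

/-- The vanishing ideal of a finite set of points of `ℙ^n`. -/
def idealOfFinset (S : Finset (Projectivization K (Fin (n+1) → K))) :
    Ideal (MvPolynomial (Fin (n+1)) K) :=
  ⨅ P ∈ S, pointIdeal P

/-- A finite set of points of `ℙ^n` is in uniform position if every subset `Y` has
Hilbert function `h_Y(ℓ) = min {|Y|, h_Γ(ℓ)}`. -/
def UniformPosition (S : Finset (Projectivization K (Fin (n+1) → K))) : Prop :=
  ∀ Y ⊆ S, ∀ ℓ : ℕ, hilbF (idealOfFinset Y) ℓ = min Y.card (hilbF (idealOfFinset S) ℓ)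

end

section HilbertFunction

variable {K : Type} [Field K] {n : ℕ}

/-- The homogeneous part of degree `m` of the ideal `I`. -/
noncomputable abbrev gradedPart (I : Ideal (MvPolynomial (Fin (n+1)) K)) (m : ℕ) :
    Submodule K (MvPolynomial (Fin (n+1)) K) :=
  I.restrictScalars K ⊓ homogeneousSubmodule (Fin (n+1)) K m

instance finite_homogeneousSubmodule (m : ℕ) :
    Module.Finite K (homogeneousSubmodule (Fin (n+1)) K m) := by
  have h : homogeneousSubmodule (Fin (n+1)) K m ≤ restrictTotalDegree (Fin (n+1)) K m :=
    fun p hp ↦ (mem_restrictTotalDegree _ _ _).2 (IsHomogeneous.totalDegree_le hp)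
  exact Module.Finite.of_injective _ (Submodule.inclusion_injective h)

lemma hilbF_add_finrank_gradedPart (I : Ideal (MvPolynomial (Fin (n+1)) K)) (m : ℕ) :
    hilbF I m + Module.finrank K (gradedPart I m) =
      Module.finrank K (homogeneousSubmodule (Fin (n+1)) K m) := by
  set S := homogeneousSubmodule (Fin (n+1)) K m
  set φ := (Ideal.Quotient.mkₐ K I).toLinearMap
  have hker : LinearMap.ker φ = I.restrictScalars K := by
    ext x
    simp [φ, Ideal.Quotient.eq_zero_iff_mem]
  have key := LinearMap.finrank_range_add_finrank_ker (φ.comp S.subtype)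
  rw [LinearMap.range_comp, Submodule.range_subtype, LinearMap.ker_comp, hker] at key
  rw [← key, (Submodule.equivSubtypeMap S _).finrank_eq, Submodule.map_comap_subtype, inf_comm]
  rfl

lemma hilbF_anti {I J : Ideal (MvPolynomial (Fin (n+1)) K)} (h : I ≤ J) (m : ℕ) :
    hilbF J m ≤ hilbF I m := by
  have h1 := hilbF_add_finrank_gradedPart I m
  have h2 := hilbF_add_finrank_gradedPart J m
  have h3 : Module.finrank K (gradedPart I m) ≤ Module.finrank K (gradedPart J m) :=
    Submodule.finrank_mono (inf_le_inf_right _ fun _ hx ↦ h hx)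
  omega

lemma mem_residualIdeal {I : Ideal (MvPolynomial (Fin (n+1)) K)}
    {f g : MvPolynomial (Fin (n+1)) K} : g ∈ residualIdeal I f ↔ f * g ∈ I := by
  rw [residualIdeal, Ideal.mem_colon_span_singleton, mul_comm]

lemma homogeneousComponent_add_mul (a : MvPolynomial (Fin (n+1)) K)
    {f : MvPolynomial (Fin (n+1)) K} {e : ℕ} (hf : f.IsHomogeneous e) (q : ℕ) :
    homogeneousComponent (q + e) (a * f) = homogeneousComponent q a * f := by
  rw [← decomposition.decompose'_apply, ← decomposition.decompose'_apply]
  exact DirectSum.coe_decompose_mul_add_of_right_mem (homogeneousSubmodule (Fin (n+1)) K) hf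

lemma finrank_map_of_injective {V W : Type*} [AddCommGroup V] [Module K V] [AddCommGroup W]
    [Module K W] {φ : V →ₗ[K] W} (hφ : Function.Injective φ) (p : Submodule K V) :
    Module.finrank K (p.map φ) = Module.finrank K p :=
  (Submodule.equivMapOfInjective φ hφ p).finrank_eq.symm

lemma gradedPart_sup_span_singleton {I : Ideal (MvPolynomial (Fin (n+1)) K)}
    (hI : I.IsHomogeneous (homogeneousSubmodule (Fin (n+1)) K))
    {f : MvPolynomial (Fin (n+1)) K} {e : ℕ} (hf : f.IsHomogeneous e) (q : ℕ) :
    gradedPart (I ⊔ Ideal.span {f}) (q + e) = gradedPart I (q + e) ⊔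
      (homogeneousSubmodule (Fin (n+1)) K q).map (LinearMap.mulLeft K f) := by
  apply le_antisymm
  · rintro g ⟨hg, hgh⟩
    obtain ⟨i, hi, b, hb, rfl⟩ := Submodule.mem_sup.1 hg
    obtain ⟨a, rfl⟩ := Ideal.mem_span_singleton'.1 hb
    rw [← homogeneousComponent_eq_self hgh, map_add, homogeneousComponent_add_mul a hf]
    refine Submodule.add_mem_sup
      ⟨homogeneousComponent_mem_of_mem hI hi _, homogeneousComponent_mem _ _⟩
      ⟨homogeneousComponent q a, homogeneousComponent_mem _ _, ?_⟩
    simp [mul_comm]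
  · refine sup_le (inf_le_inf_right _ fun x hx ↦ Ideal.mem_sup_left hx) ?_
    rintro _ ⟨a, ha, rfl⟩
    refine ⟨Ideal.mem_sup_right (Ideal.mul_mem_right _ _ (Ideal.mem_span_singleton_self f)), ?_⟩
    rw [add_comm _ e]
    exact hf.mul ha

lemma gradedPart_inf_map_mulLeft (I : Ideal (MvPolynomial (Fin (n+1)) K))
    {f : MvPolynomial (Fin (n+1)) K} {e : ℕ} (hf : f.IsHomogeneous e) (q : ℕ) :
    gradedPart I (q + e) ⊓ (homogeneousSubmodule (Fin (n+1)) K q).map (LinearMap.mulLeft K f) =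
      (gradedPart (residualIdeal I f) q).map (LinearMap.mulLeft K f) := by
  apply le_antisymm
  · rintro _ ⟨⟨hg, -⟩, a, ha, rfl⟩
    exact ⟨a, ⟨mem_residualIdeal.2 hg, ha⟩, rfl⟩
  · rintro _ ⟨a, ⟨ha, hah⟩, rfl⟩
    refine ⟨⟨mem_residualIdeal.1 ha, ?_⟩, a, hah, rfl⟩
    rw [add_comm _ e]
    exact hf.mul hah

/-- Additivity of Hilbert functions along `0 → S/(I : f)(-e) → S/I → S/(I + (f)) → 0`. -/
lemma hilbF_add_eq {I : Ideal (MvPolynomial (Fin (n+1)) K)}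
    (hI : I.IsHomogeneous (homogeneousSubmodule (Fin (n+1)) K))
    {f : MvPolynomial (Fin (n+1)) K} (hf0 : f ≠ 0) {e : ℕ} (hf : f.IsHomogeneous e) (q : ℕ) :
    hilbF I (q + e) = hilbF (residualIdeal I f) q + hilbF (I ⊔ Ideal.span {f}) (q + e) := by
  have hinj : Function.Injective (LinearMap.mulLeft K f) := mul_right_injective₀ hf0
  have key := Submodule.finrank_sup_add_finrank_inf_eq (gradedPart I (q + e))
    ((homogeneousSubmodule (Fin (n+1)) K q).map (LinearMap.mulLeft K f))
  rw [← gradedPart_sup_span_singleton hI hf, gradedPart_inf_map_mulLeft I hf,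
    finrank_map_of_injective hinj, finrank_map_of_injective hinj] at key
  have h1 := hilbF_add_finrank_gradedPart I (q + e)
  have h2 := hilbF_add_finrank_gradedPart (residualIdeal I f) q
  have h3 := hilbF_add_finrank_gradedPart (I ⊔ Ideal.span {f}) (q + e)
  omega

lemma mem_colon_irrelevantIdeal_pow {I : Ideal (MvPolynomial (Fin (n+1)) K)} {k : ℕ}
    {g : MvPolynomial (Fin (n+1)) K} :
    g ∈ Submodule.colon I ((irrelevantIdeal K n ^ k : Ideal (MvPolynomial (Fin (n+1)) K)) :
      Set (MvPolynomial (Fin (n+1)) K)) ↔ ∀ a ∈ irrelevantIdeal K n ^ k, g * a ∈ I :=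
  Submodule.mem_colon

lemma le_saturate (I : Ideal (MvPolynomial (Fin (n+1)) K)) : I ≤ saturate I := fun _ hg ↦
  Submodule.mem_iSup_of_mem 0 (mem_colon_irrelevantIdeal_pow.2 fun _ _ ↦ I.mul_mem_right _ hg)

lemma exists_saturate_eq_colon (I : Ideal (MvPolynomial (Fin (n+1)) K)) :
    ∃ k : ℕ, ∀ g ∈ saturate I, ∀ a ∈ irrelevantIdeal K n ^ k, g * a ∈ I := by
  let c : ℕ →o Ideal (MvPolynomial (Fin (n+1)) K) :=
    ⟨fun k ↦ Submodule.colon I ((irrelevantIdeal K n ^ k : Ideal (MvPolynomial (Fin (n+1)) K)) :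
      Set (MvPolynomial (Fin (n+1)) K)), fun i j hij g hg ↦
        mem_colon_irrelevantIdeal_pow.2 fun a ha ↦
          mem_colon_irrelevantIdeal_pow.1 hg a (Ideal.pow_le_pow_right hij ha)⟩
  refine ⟨monotonicSequenceLimitIndex c, fun g hg ↦ mem_colon_irrelevantIdeal_pow.1 ?_⟩
  have h : saturate I = monotonicSequenceLimit c := WellFoundedGT.iSup_eq_monotonicSequenceLimit c
  rw [h] at hg
  exact hg

lemma exists_totalDegree_le_add_mem_pow (k : ℕ) (a : MvPolynomial (Fin (n+1)) K) :
    ∃ b c, b + c = a ∧ b.totalDegree ≤ k ∧ c ∈ irrelevantIdeal K n ^ k := by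
  refine ⟨∑ i ∈ Finset.range k, homogeneousComponent i a,
    a - ∑ i ∈ Finset.range k, homogeneousComponent i a, by ring, ?_, ?_⟩
  · refine totalDegree_finsetSum_le fun i hi ↦ ?_
    exact (homogeneousComponent_isHomogeneous i a).totalDegree_le.trans (Finset.mem_range.1 hi).le
  · refine (mem_pow_idealOfVars_iff' _ _).2 fun x hx ↦ ?_
    simp [coeff_sum, coeff_homogeneousComponent, hx]

lemma eventually_hilbF_saturate {I : Ideal (MvPolynomial (Fin (n+1)) K)}
    (hI : I.IsHomogeneous (homogeneousSubmodule (Fin (n+1)) K)) :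
    ∀ᶠ m in atTop, hilbF (saturate I) m = hilbF I m := by
  obtain ⟨k, hk⟩ := exists_saturate_eq_colon I
  obtain ⟨s, hs⟩ := (isNoetherianRing_iff_ideal_fg _).1 inferInstance (saturate I)
  filter_upwards [eventually_gt_atTop (k + s.sup totalDegree)] with m hm
  refine le_antisymm (hilbF_anti (le_saturate I) m) ?_
  have hle : gradedPart (saturate I) m ≤ gradedPart I m := by
    rintro g ⟨hg, hgh⟩
    refine ⟨?_, hgh⟩
    have hdecomp : ∀ g ∈ saturate I, ∃ b c, b + c = g ∧
        b.totalDegree ≤ k + s.sup totalDegree ∧ c ∈ I := by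
      intro g hg
      rw [← hs] at hg
      obtain ⟨u, -, rfl⟩ := Submodule.mem_span_finset.1 hg
      choose b c hbc hb hc using exists_totalDegree_le_add_mem_pow (K := K) (n := n) k
      refine ⟨∑ x ∈ s, b (u x) * x, ∑ x ∈ s, c (u x) * x, ?_, ?_, ?_⟩
      · simp [← Finset.sum_add_distrib, ← add_mul, hbc]
      · refine totalDegree_finsetSum_le fun x hx ↦ (totalDegree_mul _ _).trans ?_
        exact add_le_add (hb _) (Finset.le_sup hx)
      · refine I.sum_mem fun x hx ↦ ?_
        rw [mul_comm]
        exact hk x (hs ▸ Ideal.subset_span hx) _ (hc _)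
    obtain ⟨b, c, rfl, hb, hc⟩ := hdecomp g hg
    rw [← homogeneousComponent_eq_self hgh, map_add,
      homogeneousComponent_eq_zero _ _ (hb.trans_lt hm), zero_add]
    exact homogeneousComponent_mem_of_mem hI hc m
  have h1 := hilbF_add_finrank_gradedPart I m
  have h2 := hilbF_add_finrank_gradedPart (saturate I) m
  have h3 := Submodule.finrank_mono hle
  omega

/-- Over an infinite field, some linear form is a nonzerodivisor modulo a saturated ideal. -/
lemma exists_linear_nonzerodivisor [Infinite K] {I : Ideal (MvPolynomial (Fin (n+1)) K)}
    (hI : saturate I = I) :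
    ∃ l : MvPolynomial (Fin (n+1)) K, l.IsHomogeneous 1 ∧ ∀ g, l * g ∈ I → g ∈ I := by
  set S := MvPolynomial (Fin (n+1)) K
  have hfin := associatedPrimes.finite S (S ⧸ I)
  have := hfin.to_subtype
  by_contra! hno
  let p : associatedPrimes S (S ⧸ I) → Subspace K (homogeneousSubmodule (Fin (n+1)) K 1) :=
    fun P ↦ ((P : Ideal S).restrictScalars K).comap (Submodule.subtype _)
  have hcover : ⋃ P, (p P : Set (homogeneousSubmodule (Fin (n+1)) K 1)) = Set.univ := by
    refine Set.eq_univ_of_forall fun l ↦ ?_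
    obtain ⟨g, hlg, hg⟩ := hno l l.2
    have hl : (l : S) ∈ ⋃ P ∈ associatedPrimes S (S ⧸ I), (P : Set S) := by
      rw [biUnion_associatedPrimes_eq_zero_divisors]
      exact ⟨Ideal.Quotient.mk I g, by rwa [Ne, Ideal.Quotient.eq_zero_iff_mem],
        Ideal.Quotient.eq_zero_iff_mem.2 hlg⟩
    obtain ⟨P, hP, hlP⟩ := Set.mem_iUnion₂.1 hl
    exact Set.mem_iUnion.2 ⟨⟨P, hP⟩, hlP⟩
  obtain ⟨⟨P, hP⟩, htop⟩ := Subspace.exists_eq_top_of_iUnion_eq_univ hcover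
  obtain ⟨hprime, x, hx⟩ := isAssociatedPrime_iff.1 hP
  obtain ⟨g, rfl⟩ := Ideal.Quotient.mk_surjective x
  have hle : irrelevantIdeal K n ≤ P := by
    refine Ideal.span_le.2 ?_
    rintro _ ⟨i, rfl⟩
    have : (⟨X i, isHomogeneous_X K i⟩ : homogeneousSubmodule (Fin (n+1)) K 1) ∈ p ⟨P, hP⟩ :=
      htop ▸ Submodule.mem_top
    exact this
  have hg : g ∈ I := by
    rw [← hI]
    refine Submodule.mem_iSup_of_mem 1 (mem_colon_irrelevantIdeal_pow.2 fun a ha ↦ ?_)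
    have ha' := hle (pow_one (irrelevantIdeal K n) ▸ ha)
    rw [hx, Submodule.mem_colon_singleton, Submodule.mem_bot] at ha'
    rw [mul_comm]
    exact Ideal.Quotient.eq_zero_iff_mem.1 ha'
  refine hprime.ne_top ?_
  rw [hx, Ideal.eq_top_iff_one, Submodule.mem_colon_singleton, Ideal.Quotient.eq_zero_iff_mem.2 hg]
  simp

lemma hilbF_monotone [Infinite K] {I : Ideal (MvPolynomial (Fin (n+1)) K)}
    (hI : saturate I = I) : Monotone (hilbF I) := by
  obtain ⟨l, hl, hreg⟩ := exists_linear_nonzerodivisor hI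
  refine monotone_nat_of_le_succ fun m ↦ ?_
  set φ := (Ideal.Quotient.mkₐ K I).toLinearMap
  set μ := LinearMap.mulLeft K (Ideal.Quotient.mk I l)
  have hinj : Function.Injective μ := by
    refine (injective_iff_map_eq_zero _).2 fun x hx ↦ ?_
    obtain ⟨g, rfl⟩ := Ideal.Quotient.mk_surjective x
    refine Ideal.Quotient.eq_zero_iff_mem.2 (hreg g (Ideal.Quotient.eq_zero_iff_mem.1 ?_))
    rw [map_mul]
    exact hx
  have hle : ((homogeneousSubmodule (Fin (n+1)) K m).map φ).map μ ≤
      (homogeneousSubmodule (Fin (n+1)) K (m + 1)).map φ := by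
    rintro _ ⟨_, ⟨g, hg, rfl⟩, rfl⟩
    refine ⟨l * g, ?_, map_mul (Ideal.Quotient.mk I) l g⟩
    rw [add_comm m]
    exact hl.mul hg
  have := Submodule.finrank_mono hle
  rwa [finrank_map_of_injective hinj] at this

lemma schemeDeg_eq {I : Ideal (MvPolynomial (Fin (n+1)) K)} {d : ℕ}
    (h : ∀ᶠ m in atTop, hilbF I m = d) : schemeDeg I = d := by
  have hex : ∃ d, ∀ᶠ m in atTop, hilbF I m = d := ⟨d, h⟩
  rw [schemeDeg, dif_pos hex]
  obtain ⟨m, h1, h2⟩ := (hex.choose_spec.and h).exists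
  exact h1.symm.trans h2

lemma eventually_hilbF_eq_schemeDeg {I : Ideal (MvPolynomial (Fin (n+1)) K)}
    (h : schemeDeg I ≠ 0) : ∀ᶠ m in atTop, hilbF I m = schemeDeg I := by
  have hex : ∃ d, ∀ᶠ m in atTop, hilbF I m = d := by
    by_contra hex
    exact h (dif_neg hex)
  rw [schemeDeg, dif_pos hex]
  exact hex.choose_spec

lemma schemeReg_spec {I : Ideal (MvPolynomial (Fin (n+1)) K)}
    (h : ∀ᶠ m in atTop, hilbF I m = schemeDeg I) :
    1 ≤ schemeReg I ∧ ∀ m, schemeReg I - 1 ≤ m → hilbF I m = schemeDeg I := by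
  obtain ⟨N, hN⟩ := eventually_atTop.1 h
  exact Nat.sInf_mem (s := {p : ℕ | 1 ≤ p ∧ ∀ m : ℕ, p - 1 ≤ m → hilbF I m = schemeDeg I})
    ⟨N + 1, by omega, fun m hm ↦ hN m (by omega)⟩

lemma IsFiniteSubscheme.eventually_eq {I : Ideal (MvPolynomial (Fin (n+1)) K)}
    (hI : IsFiniteSubscheme I) : ∀ᶠ m in atTop, hilbF I m = schemeDeg I := by
  obtain ⟨d, -, hd⟩ := hI.finite
  rwa [schemeDeg_eq hd]

section Residual

variable {I : Ideal (MvPolynomial (Fin (n+1)) K)} {f : MvPolynomial (Fin (n+1)) K} {e : ℕ}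

lemma eventually_hilbF_residualIdeal (hI : IsFiniteSubscheme I) (hf0 : f ≠ 0)
    (hf : f.IsHomogeneous e) (hmeet : schemeDeg (interIdeal I (Ideal.span {f})) ≠ 0) :
    ∀ᶠ m in atTop, hilbF (residualIdeal I f) m + schemeDeg (interIdeal I (Ideal.span {f})) =
      schemeDeg I := by
  have hspan : (Ideal.span {f}).IsHomogeneous (homogeneousSubmodule (Fin (n+1)) K) :=
    Ideal.homogeneous_span _ _ (by rintro _ rfl; exact ⟨e, hf⟩)
  have h1 := (tendsto_add_atTop_nat e).eventually hI.eventually_eq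
  have h2 := (tendsto_add_atTop_nat e).eventually (eventually_hilbF_eq_schemeDeg hmeet)
  have h3 := (tendsto_add_atTop_nat e).eventually
    (eventually_hilbF_saturate (hI.homog.sup hspan))
  filter_upwards [h1, h2, h3] with m h1 h2 h3
  rw [← h1, ← h2, interIdeal, h3, hilbF_add_eq hI.homog hf0 hf]

lemma schemeDeg_residualIdeal_add (hI : IsFiniteSubscheme I) (hf0 : f ≠ 0)
    (hf : f.IsHomogeneous e) (hmeet : schemeDeg (interIdeal I (Ideal.span {f})) ≠ 0) :
    schemeDeg (residualIdeal I f) + schemeDeg (interIdeal I (Ideal.span {f})) = schemeDeg I := by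
  have h := eventually_hilbF_residualIdeal hI hf0 hf hmeet
  obtain ⟨m, hm⟩ := h.exists
  rw [schemeDeg_eq (d := hilbF (residualIdeal I f) m) (h.mono fun k hk ↦ by omega), hm]

lemma schemeReg_le_max [Infinite K] (hI : IsFiniteSubscheme I) (hf0 : f ≠ 0)
    (hf : f.IsHomogeneous e) (hmeet : schemeDeg (interIdeal I (Ideal.span {f})) ≠ 0) :
    schemeReg I ≤ max (schemeReg (residualIdeal I f) + e)
      (schemeReg (interIdeal I (Ideal.span {f}))) := by
  have hdeg := schemeDeg_residualIdeal_add hI hf0 hf hmeet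
  obtain ⟨hJ1, hJ⟩ := schemeReg_spec (I := residualIdeal I f)
    ((eventually_hilbF_residualIdeal hI hf0 hf hmeet).mono fun m hm ↦ by omega)
  obtain ⟨-, hL⟩ := schemeReg_spec (eventually_hilbF_eq_schemeDeg hmeet)
  refine Nat.sInf_le ⟨by omega, fun m hm ↦ le_antisymm ?_ ?_⟩
  · obtain ⟨N, hN, hmN⟩ := (hI.eventually_eq.and (eventually_ge_atTop m)).exists
    exact hN ▸ hilbF_monotone hI.saturated hmN
  · obtain ⟨q, rfl⟩ : ∃ q, m = q + e := ⟨m - e, by omega⟩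
    rw [hilbF_add_eq hI.homog hf0 hf, hJ q (by omega), ← hdeg, ← hL (q + e) (by omega)]
    exact Nat.add_le_add_left (hilbF_anti (le_saturate _) _) _

end Residual

end HilbertFunction

/-- Lemma 4.2, second part. -/
theorem stmt13 (K : Type) [Field K] [IsAlgClosed K] [CharZero K] (n d : ℕ)
    (I : Ideal (MvPolynomial (Fin (n+1)) K))
    (hfin : IsFiniteSubscheme I) (hnd : NondegenerateScheme I)
    (hlgp : InLinGenPos I) (hdeg : schemeDeg I = d)
    (hreg : ⌈((d : ℚ) - 1) / ((n : ℚ) + (n : ℚ) / (2*(n : ℚ) + 2))⌉ + 3 ≤ (schemeReg I : ℤ))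
    (f : MvPolynomial (Fin (n+1)) K) (hf0 : f ≠ 0) (hfh : f.IsHomogeneous 2)
    (hsec : 2*n + 1 ≤ schemeDeg (interIdeal I (Ideal.span {f})))
    (hregQ : schemeReg (interIdeal I (Ideal.span {f})) < schemeReg I)
    (m m' : ℕ)
    (hm : (schemeReg I : ℤ) = ⌈((d : ℚ) - 1) / (n : ℚ)⌉ - m + 1)
    (hm' : (schemeReg (residualIdeal I f) : ℤ)
        = ⌈((schemeDeg (residualIdeal I f) : ℚ) - 1) / (n : ℚ)⌉ - m' + 1) :
    m' ≤ m := by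
  have hmeet : schemeDeg (interIdeal I (Ideal.span {f})) ≠ 0 := by omega
  have hadd := schemeDeg_residualIdeal_add hfin hf0 hfh hmeet
  have hle : schemeReg I ≤ schemeReg (residualIdeal I f) + 2 := by
    have := schemeReg_le_max hfin hf0 hfh hmeet
    omega
  rcases Nat.eq_zero_or_pos n with rfl | hn
  · simp at hreg hm
    omega
  have hnQ : (0 : ℚ) < n := by exact_mod_cast hn
  have hceil : ⌈((schemeDeg (residualIdeal I f) : ℚ) - 1) / (n : ℚ)⌉ + 2 ≤
      ⌈((d : ℚ) - 1) / (n : ℚ)⌉ := by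
    rw [← Int.ceil_add_ofNat]
    refine Int.ceil_mono ?_
    rw [div_add' _ _ _ hnQ.ne', div_le_div_iff_of_pos_right hnQ]
    have : (schemeDeg (residualIdeal I f) : ℚ) + 2 * n ≤ d := by
      exact_mod_cast (by omega : schemeDeg (residualIdeal I f) + 2 * n ≤ d)
    linarith
  omega
end

section
/- Let Γ ⊂ P^n, n ≥ 2, be a finite subscheme of degree d ≥ 4n² + 6n + 1 in linearly general position over an algebraically closed field of characteristic 0, and write d = nq + r + 2 with 0 ≤ r ≤ n−1. Then Γ lies on a rational normal curve of degree n if and only if h¹(P^n, I_Γ(q)) = r + 1. -/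
open MvPolynomial Filter
open scoped Classical

attribute [local instance] MvPolynomial.gradedAlgebra

section LinearlyGeneral

variable {K : Type} {R : Type*} [Field K] [CommRing R] [Algebra K R]

/-- The dimension over `K` of an ideal of a `K`-algebra. -/
noncomputable def idealDim (K : Type) {R : Type*} [Field K] [CommRing R] [Algebra K R]
    (J : Ideal R) : ℕ :=
  Module.finrank K (J.restrictScalars K)

/-- An algebraic form of linearly general position: `V` is a space of dimension `n + 1`
containing `1`, and any nonzero subspace `W` of `V` generates an ideal of codimension at most the
codimension of `W` in `V`. -/
structure LinearlyGeneral (V : Submodule K R) (n : ℕ) : Prop where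
  one_mem : (1 : R) ∈ V
  finrank_eq : Module.finrank K V = n + 1
  le_span : ∀ W ≤ V, W ≠ ⊥ →
    Module.finrank K R + Module.finrank K W ≤ idealDim K (Ideal.span (W : Set R)) + (n + 1)

lemma idealDim_mono [FiniteDimensional K R] {I J : Ideal R} (h : I ≤ J) :
    idealDim K I ≤ idealDim K J :=
  Submodule.finrank_mono (Submodule.restrictScalars_le K |>.2 h)

lemma idealDim_strictMono [FiniteDimensional K R] {I J : Ideal R} (h : I < J) :
    idealDim K I < idealDim K J :=
  Submodule.finrank_lt_finrank_of_lt (Submodule.restrictScalars_lt K |>.2 h)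

lemma idealDim_top : idealDim K (⊤ : Ideal R) = Module.finrank K R := by
  rw [idealDim, Submodule.restrictScalars_top]
  exact finrank_top K R

lemma idealDim_bot : idealDim K (⊥ : Ideal R) = 0 := by
  rw [idealDim, Submodule.restrictScalars_bot, finrank_bot]

lemma exists_idealDim_eq_succ [IsAlgClosed K] [FiniteDimensional K R] {I : Ideal R}
    {L : Ideal R} (hI : I < L) : ∃ J, I ≤ J ∧ J ≤ L ∧ idealDim K J = idealDim K I + 1 := by
  have : IsArtinianRing R := IsArtinianRing.of_finite K R
  obtain ⟨J, hJ, hJL⟩ := exists_covBy_le_of_lt hI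
  obtain ⟨x, hxJ, hxI⟩ := SetLike.exists_of_lt hJ.lt
  have hgen : ∀ s, s * x ∉ I → J ≤ I ⊔ Ideal.span {s * x} := by
    intro s hs
    have h1 : I < I ⊔ Ideal.span {s * x} :=
      lt_of_le_of_ne le_sup_left fun h => hs (by
        rw [h]; exact Ideal.mem_sup_right (Ideal.mem_span_singleton_self _))
    have h2 : I ⊔ Ideal.span {s * x} ≤ J :=
      sup_le hJ.le ((Ideal.span_singleton_le_iff_mem _).2 (J.mul_mem_left _ hxJ))
    exact (eq_of_le_of_not_lt h2 (hJ.2 h1)).ge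
  let P : Ideal R := Submodule.colon I {x}
  have hP : ∀ r, r ∈ P ↔ r * x ∈ I := fun r => Submodule.mem_colon_singleton
  have hprime : P.IsPrime := by
    refine Ideal.isPrime_iff.2 ⟨fun h => hxI ?_, fun {a b} hab => ?_⟩
    · simpa using (hP 1).1 (h ▸ Submodule.mem_top)
    · by_contra! hcon
      obtain ⟨j, hj, y, hy, hjy⟩ := Submodule.mem_sup.1 (hgen a (fun h => hcon.1 ((hP a).2 h)) hxJ)
      obtain ⟨r, rfl⟩ := Ideal.mem_span_singleton'.1 hy
      refine hcon.2 ((hP b).2 ?_)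
      have h3 : b * x = b * j + r * ((a * b) * x) := by
        linear_combination (-b) * hjy
      rw [h3]
      exact I.add_mem (I.mul_mem_left _ hj) (I.mul_mem_left _ ((hP _).1 hab))
  have hbij := IsAlgClosed.algebraMap_bijective_of_isIntegral (k := K) (K := R ⧸ P)
  have hle : J.restrictScalars K ≤ I.restrictScalars K ⊔ Submodule.span K {x} := by
    intro y hy
    obtain ⟨j, hj, y', hy', rfl⟩ := Submodule.mem_sup.1 (hgen 1 (by simpa using hxI) hy)
    obtain ⟨r, rfl⟩ := Ideal.mem_span_singleton'.1 hy'
    obtain ⟨c, hc⟩ := hbij.2 (Ideal.Quotient.mk P r)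
    have h4 : r - algebraMap K R c ∈ P := by
      rw [← Ideal.Quotient.mk_eq_mk_iff_sub_mem, ← hc]; rfl
    refine Submodule.mem_sup.2 ⟨j + (r - algebraMap K R c) * x, I.add_mem hj ((hP _).1 h4),
      c • x, Submodule.smul_mem _ _ (Submodule.mem_span_singleton_self x), ?_⟩
    rw [Algebra.smul_def]; ring
  refine ⟨J, hJ.le, hJL, le_antisymm ?_ (idealDim_strictMono hJ.lt)⟩
  exact (Submodule.finrank_mono hle).trans ((Submodule.finrank_add_le_finrank_add_finrank _ _).trans
    (Nat.add_le_add_left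
      (finrank_span_singleton (K := K) (fun h : x = 0 => hxI (h ▸ I.zero_mem))).le _))

lemma exists_idealDim_eq [IsAlgClosed K] [FiniteDimensional K R] {I : Ideal R} {k : ℕ}
    (hI : idealDim K I ≤ k) (hk : k ≤ Module.finrank K R) : ∃ J, I ≤ J ∧ idealDim K J = k := by
  induction k, hI using Nat.le_induction with
  | base => exact ⟨I, le_rfl, rfl⟩
  | succ k _ ih =>
    obtain ⟨J, hIJ, hJ⟩ := ih (by omega)
    obtain ⟨J', hJJ', -, hJ'⟩ := exists_idealDim_eq_succ (K := K) (I := J) (L := ⊤) (by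
      refine lt_top_iff_ne_top.2 ?_
      rintro rfl
      rw [idealDim_top] at hJ
      omega)
    exact ⟨J', hIJ.trans hJJ', by omega⟩

namespace LinearlyGeneral

variable {V : Submodule K R} {n : ℕ}

lemma one_mem_pow (hV : LinearlyGeneral V n) (k : ℕ) : 1 ∈ V ^ k :=
  Submodule.one_le.1 (one_le_pow_of_one_le' (Submodule.one_le.2 hV.one_mem) k)

lemma finrank_inf_add [FiniteDimensional K R] {A : Submodule K R} {J : Ideal R}
    (h : A ⊔ J.restrictScalars K = ⊤) :
    Module.finrank K (A ⊓ J.restrictScalars K : Submodule K R) + Module.finrank K R =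
      Module.finrank K A + idealDim K J := by
  have := Submodule.finrank_sup_add_finrank_inf_eq A (J.restrictScalars K)
  rw [h, finrank_top] at this
  rw [idealDim, ← this, add_comm]

lemma le_pow_succ (hV : LinearlyGeneral V n) (k : ℕ) : V ≤ V ^ (k + 1) := by
  calc V = 1 * V := (one_mul V).symm
    _ ≤ V ^ k * V := mul_le_mul_left (Submodule.one_le.2 (hV.one_mem_pow k)) V
    _ = V ^ (k + 1) := (pow_succ V k).symm

/-- Multiplication by `a` has kernel the annihilator of `a` and image `(a)`. -/
lemma idealDim_span_add_colon [FiniteDimensional K R] (a : R) :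
    idealDim K (Ideal.span {a}) + idealDim K (Submodule.colon (⊥ : Ideal R) {a}) =
      Module.finrank K R := by
  rw [← LinearMap.finrank_range_add_finrank_ker (LinearMap.mulLeft K a)]
  have h1 : (Ideal.span {a}).restrictScalars K = LinearMap.range (LinearMap.mulLeft K a) := by
    ext x
    simp [Ideal.mem_span_singleton', mul_comm]
  have h2 : (Submodule.colon (⊥ : Ideal R) {a}).restrictScalars K =
      LinearMap.ker (LinearMap.mulLeft K a) := by
    ext x
    simp [Submodule.mem_colon_singleton, mul_comm]
  rw [idealDim, idealDim, h1, h2]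

open Polynomial in
/-- A chain `w` with `a * w (i + 1) = b * w i` is linearly independent, provided that the pencil
spanned by `a` and `b` has no zero divisors relative to `V`. -/
lemma sum_coeff_smul_ne_zero [IsAlgClosed K] {a b : R} (m : ℕ) {w : ℕ → R}
    (hab : ∀ c : K, ∀ v ∈ V, (b - c • a) * v = 0 → v = 0)
    (hmem : ∀ i ≤ m, w i ∈ V) (hw : ∀ i < m, a * w (i + 1) = b * w i) (h0 : w 0 ≠ 0) {p : K[X]}
    (hp0 : p ≠ 0) (hp : p.natDegree ≤ m) : ∑ i ∈ Finset.range (m + 1), p.coeff i • w i ≠ 0 := by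
  induction m generalizing w p with
  | zero =>
    rw [Polynomial.eq_C_of_natDegree_le_zero hp] at hp0 ⊢
    simpa [h0] using hp0
  | succ m ih =>
    by_cases hdeg : p.degree = 0
    · rw [Polynomial.eq_C_of_degree_eq_zero hdeg] at hp0 ⊢
      rw [Finset.sum_range_succ', Finset.sum_eq_zero fun i _ => by
        rw [Polynomial.coeff_C_succ, zero_smul]]
      simpa [h0] using hp0
    obtain ⟨c, hc⟩ := IsAlgClosed.exists_root p hdeg
    obtain ⟨p', rfl⟩ := Polynomial.dvd_iff_isRoot.2 hc
    have hp' : p' ≠ 0 := right_ne_zero_of_mul hp0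
    rw [Polynomial.natDegree_mul (Polynomial.X_sub_C_ne_zero c) hp',
      Polynomial.natDegree_X_sub_C] at hp
    have hsum : ∑ i ∈ Finset.range (m + 1 + 1),
        ((Polynomial.X - Polynomial.C c) * p').coeff i • w i =
        ∑ i ∈ Finset.range (m + 1), p'.coeff i • (w (i + 1) - c • w i) := by
      simp only [sub_mul, Polynomial.coeff_sub, sub_smul, Finset.sum_sub_distrib, smul_sub]
      congr 1
      · rw [Finset.sum_range_succ']
        simp
      · rw [Finset.sum_range_succ, Polynomial.coeff_C_mul,
          Polynomial.coeff_eq_zero_of_natDegree_lt (by omega)]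
        simp [mul_smul, smul_comm c]
    rw [hsum]
    refine ih (w := fun i => w (i + 1) - c • w i) (fun i hi => ?_) (fun i hi => ?_) (fun h => h0 ?_)
      hp' (by omega)
    · exact V.sub_mem (hmem _ (by omega)) (V.smul_mem _ (hmem _ (by omega)))
    · rw [mul_sub, mul_sub, hw _ (by omega), mul_smul_comm, mul_smul_comm, hw _ (by omega)]
    · refine hab c _ (hmem 0 (by omega)) ?_
      rw [sub_mul, ← hw 0 (by omega), smul_mul_assoc, ← mul_smul_comm, ← mul_sub]
      exact h ▸ mul_zero a

variable [FiniteDimensional K R]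

lemma sup_eq_top (hV : LinearlyGeneral V n) {J : Ideal R}
    (hJ : Module.finrank K R ≤ idealDim K J + (n + 1)) : V ⊔ J.restrictScalars K = ⊤ := by
  by_contra hne
  have h1 := Submodule.finrank_sup_add_finrank_inf_eq V (J.restrictScalars K)
  have h2 := Submodule.finrank_lt hne
  rw [hV.finrank_eq] at h1
  change _ = _ + idealDim K J at h1
  have h3 : V ⊓ J.restrictScalars K ≠ ⊥ := by
    intro h
    rw [h, finrank_bot] at h1
    omega
  have h4 := hV.le_span _ inf_le_left h3
  have h5 : idealDim K (Ideal.span ((V ⊓ J.restrictScalars K : Submodule K R) : Set R)) ≤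
      idealDim K J := idealDim_mono (Ideal.span_le.2 fun x hx => hx.2)
  omega

lemma le_idealDim_span_singleton (hV : LinearlyGeneral V n) {a : R} (ha : a ∈ V) (h0 : a ≠ 0) :
    Module.finrank K R ≤ idealDim K (Ideal.span {a}) + n := by
  have h1 := hV.le_span (Submodule.span K {a}) (by simpa using ha) (by simpa using h0)
  rw [finrank_span_singleton h0] at h1
  have h2 : idealDim K (Ideal.span ((Submodule.span K {a} : Submodule K R) : Set R)) ≤
      idealDim K (Ideal.span {a}) := by
    refine idealDim_mono (Ideal.span_le.2 fun x hx => ?_)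
    obtain ⟨c, rfl⟩ := Submodule.mem_span_singleton.1 hx
    rw [Algebra.smul_def]
    exact Ideal.mul_mem_left _ _ (Ideal.mem_span_singleton_self a)
  omega

/-- An ideal of codimension at most `n` contains a nonzero element of `V`. -/
lemma exists_mem_ne_zero (hV : LinearlyGeneral V n) {J : Ideal R}
    (hJ : Module.finrank K R ≤ idealDim K J + n) : ∃ a ∈ V, a ∈ J ∧ a ≠ 0 := by
  have h1 := finrank_inf_add (hV.sup_eq_top (J := J) (by omega))
  rw [hV.finrank_eq] at h1
  have h3 : V ⊓ J.restrictScalars K ≠ ⊥ := by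
    intro h
    rw [h, finrank_bot] at h1
    omega
  obtain ⟨a, ha, h0⟩ := Submodule.exists_mem_ne_zero_of_ne_bot h3
  exact ⟨a, ha.1, ha.2, h0⟩

lemma pow_sup_eq_top [IsAlgClosed K] (hV : LinearlyGeneral V n) (k : ℕ) {J : Ideal R}
    (hJ : Module.finrank K R ≤ idealDim K J + (n * k + 1)) :
    V ^ k ⊔ J.restrictScalars K = ⊤ := by
  induction k generalizing J with
  | zero =>
    by_cases h1 : (1 : R) ∈ J
    · rw [(Ideal.eq_top_iff_one J).2 h1]; simp
    · refine Submodule.eq_top_of_finrank_eq (le_antisymm (Submodule.finrank_le _) (hJ.trans ?_))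
      refine Submodule.finrank_lt_finrank_of_lt (lt_of_le_of_ne le_sup_right fun h => h1 ?_)
      have : (1 : R) ∈ V ^ 0 ⊔ J.restrictScalars K := Submodule.mem_sup_left (hV.one_mem_pow 0)
      rw [← h] at this
      exact this
  | succ k ih =>
    by_cases hn : Module.finrank K R ≤ idealDim K J + (n + 1)
    · refine eq_top_iff.2 ((hV.sup_eq_top hn).ge.trans (sup_le_sup_right (hV.le_pow_succ k) _))
    obtain ⟨J₁, hJJ₁, hJ₁⟩ := exists_idealDim_eq (K := K) (I := J)
      (k := Module.finrank K R - n) (by omega) (by omega)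
    obtain ⟨a, haV, haJ, ha0⟩ := hV.exists_mem_ne_zero (J := J₁) (by omega)
    have hcol : Module.finrank K R ≤ idealDim K (Submodule.colon J {a}) + (n * k + 1) := by
      have h1 := LinearMap.finrank_range_add_finrank_ker
        ((J.restrictScalars K).mkQ ∘ₗ LinearMap.mulRight K a)
      have h2 : LinearMap.ker ((J.restrictScalars K).mkQ ∘ₗ LinearMap.mulRight K a) =
          (Submodule.colon J {a}).restrictScalars K := by
        ext x
        simp [Submodule.mem_colon_singleton]
      rw [h2] at h1
      have h3 : LinearMap.range ((J.restrictScalars K).mkQ ∘ₗ LinearMap.mulRight K a) ≤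
          (J₁.restrictScalars K).map (J.restrictScalars K).mkQ := by
        rintro _ ⟨x, rfl⟩
        exact ⟨x * a, J₁.mul_mem_left _ haJ, rfl⟩
      have h4 := Submodule.finrank_mono h3
      have h5 := LinearMap.finrank_range_add_finrank_ker
        ((J.restrictScalars K).mkQ.domRestrict (J₁.restrictScalars K))
      have h6 : Module.finrank K (LinearMap.ker
          ((J.restrictScalars K).mkQ.domRestrict (J₁.restrictScalars K))) = idealDim K J := by
        rw [LinearMap.ker_domRestrict, Submodule.ker_mkQ]
        exact (Submodule.comapSubtypeEquivOfLe (p := J.restrictScalars K)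
          (q := J₁.restrictScalars K) hJJ₁).finrank_eq
      rw [LinearMap.range_domRestrict, h6] at h5
      change _ = idealDim K J₁ at h5
      change _ + idealDim K _ = _ at h1
      have h7 : n * (k + 1) = n * k + n := by ring
      omega
    have ih' := ih hcol
    have hspan := hV.le_idealDim_span_singleton haV ha0
    have htop := hV.sup_eq_top (J := Ideal.span {a}) (by omega)
    rw [eq_top_iff, ← htop]
    refine sup_le ((hV.le_pow_succ k).trans le_sup_left) fun y hy => ?_
    obtain ⟨r, rfl⟩ := Ideal.mem_span_singleton'.1 hy
    obtain ⟨s, hs, t, ht, rfl⟩ := Submodule.mem_sup.1 (ih'.ge (Submodule.mem_top (x := r)))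
    rw [add_mul]
    refine Submodule.add_mem_sup ?_ (Submodule.mem_colon_singleton.1 ht)
    rw [pow_succ]
    exact Submodule.mul_mem_mul hs haV

/-- If `V ^ k` has the minimal dimension `n * k + 1`, its nonzero elements generate ideals of
codimension at most `n * k`. -/
lemma le_idealDim_of_mem_pow [IsAlgClosed K] (hV : LinearlyGeneral V n) {k : ℕ}
    (hk : Module.finrank K (V ^ k : Submodule K R) = n * k + 1) {f : R} (hf : f ∈ V ^ k)
    (h0 : f ≠ 0) : Module.finrank K R ≤ idealDim K (Ideal.span {f}) + n * k := by
  by_contra! hlt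
  have h1 := Submodule.finrank_le (V ^ k)
  obtain ⟨J, hfJ, hJ⟩ := exists_idealDim_eq (K := K) (I := Ideal.span {f})
    (k := Module.finrank K R - (n * k + 1)) (by omega) (by omega)
  have h2 := finrank_inf_add (hV.pow_sup_eq_top k (J := J) (by omega))
  have h3 : (V ^ k ⊓ J.restrictScalars K : Submodule K R) = ⊥ :=
    Submodule.finrank_eq_zero.1 (by omega)
  exact h0 ((Submodule.mem_bot K).1 (h3 ▸ ⟨hf, hfJ (Ideal.mem_span_singleton_self f)⟩))

/-- If `V ^ k` has the minimal dimension `n * k + 1` and is not all of `R`, it contains no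
nonzero ideal. -/
lemma eq_zero_of_forall_mul_mem_pow [IsAlgClosed K] (hV : LinearlyGeneral V n) {k : ℕ}
    (hk : Module.finrank K (V ^ k : Submodule K R) = n * k + 1)
    (hR : n * k + 1 < Module.finrank K R) {f : R} (hf : ∀ r, r * f ∈ V ^ k) : f = 0 := by
  by_contra h0
  have hlt : (⊥ : Ideal R) < Ideal.span {f} :=
    bot_lt_iff_ne_bot.2 fun h => h0 (Ideal.span_singleton_eq_bot.1 h)
  obtain ⟨J, -, hJf, hJ⟩ := exists_idealDim_eq_succ (K := K) hlt
  have hbot := idealDim_bot (K := K) (R := R)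
  have hJ0 : J ≠ ⊥ := by
    rintro rfl
    omega
  obtain ⟨g, hgJ, hg0⟩ := Submodule.exists_mem_ne_zero_of_ne_bot hJ0
  obtain ⟨r, hr⟩ := Ideal.mem_span_singleton'.1 (hJf hgJ)
  have h1 := hV.le_idealDim_of_mem_pow hk (hr ▸ hf r) hg0
  have h2 : idealDim K (Ideal.span {g}) ≤ idealDim K J :=
    idealDim_mono ((Ideal.span_singleton_le_iff_mem _).2 hgJ)
  omega

lemma le_finrank_pow [IsAlgClosed K] (hV : LinearlyGeneral V n) {k : ℕ}
    (hR : n * k + 1 ≤ Module.finrank K R) :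
    n * k + 1 ≤ Module.finrank K (V ^ k : Submodule K R) := by
  have hbot := idealDim_bot (K := K) (R := R)
  obtain ⟨J, -, hJ⟩ := exists_idealDim_eq (K := K) (I := (⊥ : Ideal R))
    (k := Module.finrank K R - (n * k + 1)) (by omega) (by omega)
  have h1 := finrank_inf_add (hV.pow_sup_eq_top k (J := J) (by omega))
  omega

lemma finrank_pow_of_finrank_pow_succ [IsAlgClosed K] (hV : LinearlyGeneral V n) {k : ℕ}
    (hk : Module.finrank K (V ^ (k + 1) : Submodule K R) = n * (k + 1) + 1)
    (hR : n * (k + 1) + 1 < Module.finrank K R) :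
    Module.finrank K (V ^ k : Submodule K R) = n * k + 1 := by
  have hnk : n * (k + 1) = n * k + n := by ring
  refine le_antisymm ?_ ?_
  · have hbot : idealDim K (⊥ : Ideal R) = 0 := by
      rw [idealDim, Submodule.restrictScalars_bot, finrank_bot]
    obtain ⟨J, -, hJ⟩ := exists_idealDim_eq (K := K) (I := (⊥ : Ideal R))
      (k := Module.finrank K R - n) (by omega) (by omega)
    obtain ⟨a, haV, haJ, ha0⟩ := hV.exists_mem_ne_zero (J := J) (by omega)
    have hinj : Function.Injective ((LinearMap.mulRight K a).domRestrict (V ^ k)) := by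
      refine (injective_iff_map_eq_zero _).2 ?_
      rintro ⟨f, hf⟩ hfa
      replace hfa : f * a = 0 := hfa
      refine Subtype.ext (hV.eq_zero_of_forall_mul_mem_pow hk hR fun r => ?_)
      have h1 : Ideal.span {a} ≤ Submodule.colon (⊥ : Ideal R) {f} :=
        (Ideal.span_singleton_le_iff_mem _).2
          (Submodule.mem_colon_singleton.2 (by simpa [mul_comm] using hfa))
      have h2 := hV.le_idealDim_span_singleton haV ha0
      have h3 := idealDim_mono (K := K) h1
      have h4 := hV.sup_eq_top (J := Submodule.colon (⊥ : Ideal R) {f}) (by omega)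
      obtain ⟨s, hs, t, ht, rfl⟩ := Submodule.mem_sup.1 (h4.ge (Submodule.mem_top (x := r)))
      have h5 : t * f = 0 := by simpa using Submodule.mem_colon_singleton.1 ht
      rw [add_mul, h5, add_zero, mul_comm, pow_succ]
      exact Submodule.mul_mem_mul hf hs
    have h6 := LinearMap.finrank_range_of_inj hinj
    have h7 : LinearMap.range ((LinearMap.mulRight K a).domRestrict (V ^ k)) ≤
        V ^ (k + 1) ⊓ J.restrictScalars K := by
      rintro _ ⟨⟨f, hf⟩, rfl⟩
      refine ⟨?_, J.mul_mem_left f haJ⟩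
      rw [pow_succ]
      exact Submodule.mul_mem_mul hf haV
    have h8 := Submodule.finrank_mono h7
    have h9 := finrank_inf_add (hV.pow_sup_eq_top (k + 1) (J := J) (by omega))
    omega
  · exact hV.le_finrank_pow (by omega)

lemma finrank_pow_of_le [IsAlgClosed K] (hV : LinearlyGeneral V n) {q k : ℕ} (hkq : k ≤ q)
    (hq : Module.finrank K (V ^ q : Submodule K R) = n * q + 1)
    (hR : n * q + 1 < Module.finrank K R) :
    Module.finrank K (V ^ k : Submodule K R) = n * k + 1 := by
  induction q, hkq using Nat.le_induction with
  | base => exact hq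
  | succ q _ ih =>
    refine ih (hV.finrank_pow_of_finrank_pow_succ hq hR) (lt_of_le_of_lt ?_ hR)
    exact Nat.add_le_add_right (Nat.mul_le_mul_left n q.le_succ) 1

lemma eq_zero_or_eq_zero_of_mul_eq_zero [IsAlgClosed K] (hV : LinearlyGeneral V n) {q k j : ℕ}
    (hkj : k + j ≤ q) (hq : Module.finrank K (V ^ q : Submodule K R) = n * q + 1)
    (hR : n * q + 1 < Module.finrank K R) {f g : R} (hf : f ∈ V ^ k) (hg : g ∈ V ^ j)
    (hfg : f * g = 0) : f = 0 ∨ g = 0 := by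
  by_contra! h
  have h1 := hV.le_idealDim_of_mem_pow (hV.finrank_pow_of_le (by omega) hq hR) hf h.1
  have h2 := hV.le_idealDim_of_mem_pow (hV.finrank_pow_of_le (by omega) hq hR) hg h.2
  have h3 := idealDim_span_add_colon (K := K) f
  have h4 : Ideal.span {g} ≤ Submodule.colon (⊥ : Ideal R) {f} :=
    (Ideal.span_singleton_le_iff_mem _).2
      (Submodule.mem_colon_singleton.2 (by simpa [mul_comm] using hfg))
  have h5 := idealDim_mono (K := K) h4
  have h6 : n * k + n * j ≤ n * q := by
    rw [← mul_add]
    exact Nat.mul_le_mul_left n hkj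
  omega

/-- If `V ^ q` has the minimal dimension `n * q + 1`, then `V` has a basis whose elements
multiply like the monomials of degree `n` in two variables. -/
lemma exists_basis [IsAlgClosed K] (hV : LinearlyGeneral V n) {q : ℕ} (hn : 1 ≤ n)
    (h3q : 3 ≤ q) (hq : Module.finrank K (V ^ q : Submodule K R) = n * q + 1)
    (hR : n * q + 1 < Module.finrank K R) :
    ∃ u : ℕ → R, LinearIndependent K (fun i : Fin (n + 1) => u i) ∧
      Submodule.span K (Set.range fun i : Fin (n + 1) => u i) = V ∧
      ∀ i < n, ∀ j < n, u (i + 1) * u j = u i * u (j + 1) := by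
  have hnq : n * 2 ≤ n * q := Nat.mul_le_mul_left n (by omega)
  have hV2 := hV.finrank_pow_of_le (k := 2) (by omega) hq hR
  have hdom : ∀ x ∈ V, ∀ y ∈ V, x * y = 0 → x = 0 ∨ y = 0 := fun x hx y hy h =>
    hV.eq_zero_or_eq_zero_of_mul_eq_zero (k := 1) (j := 1) (by omega) hq hR
      (by rwa [pow_one]) (by rwa [pow_one]) h
  have hbot := idealDim_bot (K := K) (R := R)
  obtain ⟨J, -, hJ⟩ := exists_idealDim_eq (K := K) (I := (⊥ : Ideal R))
      (k := Module.finrank K R - (n - 1)) (by omega) (by omega)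
  have hVJ := finrank_inf_add (hV.sup_eq_top (J := J) (by omega))
  have hV2J := finrank_inf_add (hV.pow_sup_eq_top 2 (J := J) (by omega))
  rw [hV.finrank_eq] at hVJ
  obtain ⟨a, ha, ha0⟩ := Submodule.exists_mem_ne_zero_of_ne_bot
    (p := V ⊓ J.restrictScalars K) (by
      intro h
      rw [h, finrank_bot] at hVJ
      omega)
  have hnot : ¬ V ⊓ J.restrictScalars K ≤ Submodule.span K {a} := fun h => by
    have := Submodule.finrank_mono h
    rw [finrank_span_singleton ha0] at this
    omega
  obtain ⟨b, hb, hba⟩ := SetLike.not_le_iff_exists.1 hnot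
  have hpencil : ∀ c : K, b - c • a ≠ 0 := fun c h =>
    hba (Submodule.mem_span_singleton.2 ⟨c, (sub_eq_zero.1 h).symm⟩)
  have hpencil' : ∀ c : K, ∀ v ∈ V, (b - c • a) * v = 0 → v = 0 := fun c v hv h =>
    (hdom _ (V.sub_mem hb.1 (V.smul_mem _ ha.1)) _ hv h).resolve_left (hpencil c)
  have hb0 : b ≠ 0 := by simpa using hpencil 0
  have hfin : ∀ x ∈ V, x ≠ 0 → ∀ U ≤ V,
      Module.finrank K (U.map (LinearMap.mulLeft K x)) = Module.finrank K U := by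
    intro x hx hx0 U hU
    rw [← LinearMap.range_domRestrict]
    refine LinearMap.finrank_range_of_inj ((injective_iff_map_eq_zero _).2 ?_)
    rintro ⟨y, hy⟩ hxy
    exact Subtype.ext ((hdom x hx y (hU hy) hxy).resolve_left hx0)
  have hmapJ : ∀ x ∈ V ⊓ J.restrictScalars K, ∀ U ≤ V,
      U.map (LinearMap.mulLeft K x) ≤ V ^ 2 ⊓ J.restrictScalars K := by
    rintro x hx U hU _ ⟨y, hy, rfl⟩
    refine ⟨?_, J.mul_mem_right y hx.2⟩
    rw [pow_two]
    exact Submodule.mul_mem_mul hx.1 (hU hy)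
  have hchain : ∀ k ≤ n, ∃ U ≤ V, n + 1 ≤ Module.finrank K U + k ∧ ∀ v ∈ U, ∃ w : ℕ → R,
      w 0 = v ∧ (∀ i ≤ k, w i ∈ V) ∧ ∀ i < k, a * w (i + 1) = b * w i := by
    intro k
    induction k with
    | zero =>
      refine fun _ => ⟨V, le_rfl, hV.finrank_eq.ge,
        fun v hv => ⟨fun _ => v, rfl, fun _ _ => hv, ?_⟩⟩
      simp
    | succ k ih =>
      intro hk
      obtain ⟨U, hUV, hU, hw⟩ := ih (by omega)
      refine ⟨V ⊓ (U.map (LinearMap.mulLeft K a)).comap (LinearMap.mulLeft K b), inf_le_left, ?_,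
        fun v hv => ?_⟩
      · have h1 := Submodule.finrank_sup_add_finrank_inf_eq
          (V.map (LinearMap.mulLeft K b)) (U.map (LinearMap.mulLeft K a))
        rw [hfin b hb.1 hb0 V le_rfl, hfin a ha.1 ha0 U hUV, hV.finrank_eq] at h1
        have h2 := Submodule.finrank_mono (sup_le (hmapJ b hb V le_rfl) (hmapJ a ha U hUV))
        rw [Submodule.map_inf_eq_map_inf_comap] at h1
        have h3 := Submodule.finrank_map_le (LinearMap.mulLeft K b)
          (V ⊓ (U.map (LinearMap.mulLeft K a)).comap (LinearMap.mulLeft K b))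
        omega
      · obtain ⟨hvV, y, hy, hyv⟩ := hv
        obtain ⟨w, rfl, hwV, hwab⟩ := hw y hy
        refine ⟨fun i => Nat.casesOn i v w, rfl, fun i hi => ?_, fun i hi => ?_⟩
        · cases i with
          | zero => exact hvV
          | succ i => exact hwV i (by omega)
        · cases i with
          | zero => exact hyv
          | succ i => exact hwab i (by omega)
  obtain ⟨U, hUV, hU, hchainU⟩ := hchain n le_rfl
  obtain ⟨v, hvU, hv0⟩ := Submodule.exists_mem_ne_zero_of_ne_bot (p := U) (by
    rintro rfl
    rw [finrank_bot] at hU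
    omega)
  obtain ⟨u, rfl, huV, hu⟩ := hchainU v hvU
  have hli : LinearIndependent K (fun i : Fin (n + 1) => u i) := by
    refine Fintype.linearIndependent_iff.2 fun g hg => ?_
    by_contra! hne
    obtain ⟨i₀, hi₀⟩ := hne
    refine sum_coeff_smul_ne_zero n hpencil' huV hu hv0 (p := Polynomial.ofFn (n + 1) g) ?_ ?_ ?_
    · intro h
      apply hi₀
      rw [← Polynomial.ofFn_coeff_eq_val_of_lt g i₀.2, h, Polynomial.coeff_zero]
    · exact Nat.le_of_lt_succ (Polynomial.ofFn_natDegree_lt (by omega) g)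
    · rw [← hg, Finset.sum_range]
      exact Finset.sum_congr rfl fun i _ => by rw [Polynomial.ofFn_coeff_eq_val_of_lt g i.2]
  refine ⟨u, hli, ?_, fun i hi j hj => ?_⟩
  · refine Submodule.eq_of_le_of_finrank_eq (Submodule.span_le.2 ?_) ?_
    · rintro _ ⟨i, rfl⟩
      exact huV i (Nat.le_of_lt_succ i.2)
    · rw [finrank_span_eq_card hli, Fintype.card_fin, hV.finrank_eq]
  · refine sub_eq_zero.1 ((hV.eq_zero_or_eq_zero_of_mul_eq_zero (k := 1) (j := 2) h3q hq hR
      (by rw [pow_one]; exact ha.1) ?_ ?_).resolve_left ha0)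
    · rw [pow_two]
      exact Submodule.sub_mem _ (Submodule.mul_mem_mul (huV _ (by omega)) (huV _ (by omega)))
        (Submodule.mul_mem_mul (huV _ (by omega)) (huV _ (by omega)))
    · linear_combination u j * hu i hi - u i * hu j hj

end LinearlyGeneral

end LinearlyGeneral

section RationalNormalCurve

variable {K : Type} {R : Type*} [Field K] [CommRing R] [Algebra K R] {n : ℕ}

/-- The product `u i₁ * ⋯ * u iₘ` of elements of a family `u 0, …, u n`, where the indices
`i₁, …, iₘ` with sum `c` are chosen greedily. -/
def greedyProd (u : ℕ → R) (n : ℕ) : ℕ → ℕ → R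
  | 0, _ => 1
  | m + 1, c => u (min c n) * greedyProd u n m (c - min c n)

lemma mul_eq_mul_of_exchange {u : ℕ → R}
    (hu : ∀ i < n, ∀ j < n, u (i + 1) * u j = u i * u (j + 1)) (t : ℕ) {i j : ℕ}
    (hi : i + t ≤ n) (hj : j + t ≤ n) : u i * u (j + t) = u (i + t) * u j := by
  induction t generalizing i with
  | zero => rfl
  | succ t ih =>
    rw [← add_assoc, ← hu i (by omega) (j + t) (by omega), ih (by omega) (by omega)]
    congr 2
    ring

lemma mul_greedyProd {u : ℕ → R}
    (hu : ∀ i < n, ∀ j < n, u (i + 1) * u j = u i * u (j + 1)) (m : ℕ) {j b : ℕ}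
    (hj : j ≤ n) (hb : b ≤ n * m) : u j * greedyProd u n m b = greedyProd u n (m + 1) (j + b) := by
  induction m generalizing j b with
  | zero =>
    obtain rfl : b = 0 := by omega
    simp [greedyProd, hj]
  | succ m ih =>
    have hm : n * (m + 1) = n * m + n := by ring
    rw [greedyProd, greedyProd.eq_def u n (m + 1 + 1)]
    dsimp only
    by_cases hbn : b ≤ n
    · rw [min_eq_left hbn, Nat.sub_self]
      by_cases hjb : j + b ≤ n
      · have h := mul_eq_mul_of_exchange hu b (i := j) (j := 0) hjb (by omega)
        rw [zero_add] at h
        rw [min_eq_left hjb, Nat.sub_self, greedyProd, Nat.zero_min, Nat.sub_self, ← mul_assoc, h,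
          mul_assoc]
      · have h := mul_eq_mul_of_exchange hu (n - j) (i := j) (j := j + b - n) (by omega) (by omega)
        rw [show j + b - n + (n - j) = b by omega, show j + (n - j) = n by omega] at h
        rw [min_eq_right (by omega), ← mul_assoc, h, mul_assoc, ih (by omega) (by omega), add_zero]
    · rw [min_eq_right (by omega), min_eq_right (by omega), mul_left_comm,
        ih hj (by omega), show j + (b - n) = j + b - n by omega]

/-- The linear map sending a binary monomial of degree `n * m` to the corresponding product of
`m` elements of the family `u`. -/
noncomputable def greedyMap (K : Type) {R : Type*} [Field K] [CommRing R] [Algebra K R]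
    (u : ℕ → R) (n m : ℕ) : MvPolynomial (Fin 2) K →ₗ[K] R :=
  (MvPolynomial.basisMonomials (Fin 2) K).constr K fun e => greedyProd u n m (e 1)

lemma greedyMap_monomial (u : ℕ → R) (m : ℕ) (e : Fin 2 →₀ ℕ) (c : K) :
    greedyMap K u n m (monomial e c) = c • greedyProd u n m (e 1) := by
  have h : greedyMap K u n m (monomial e 1) = greedyProd u n m (e 1) := by
    have h := (MvPolynomial.basisMonomials (Fin 2) K).constr_basis K
      (fun e => greedyProd u n m (e 1)) e
    rwa [MvPolynomial.coe_basisMonomials] at h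
  rw [← h, ← map_smul, MvPolynomial.smul_monomial, smul_eq_mul, mul_one]

/-- The linear map sending the `j`-th unit vector to the `j`-th binary monomial of degree `n`. -/
noncomputable def binaryForm (K : Type) [Field K] (n : ℕ) :
    (Fin (n + 1) → K) →ₗ[K] MvPolynomial (Fin 2) K :=
  Fintype.linearCombination K fun j : Fin (n + 1) => X 0 ^ (n - j : ℕ) * X 1 ^ (j : ℕ)

lemma X_pow_mul_X_pow (a b : ℕ) :
    (X 0 ^ a * X 1 ^ b : MvPolynomial (Fin 2) K) =
      monomial (Finsupp.single 0 a + Finsupp.single 1 b) 1 := by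
  rw [MvPolynomial.X_pow_eq_monomial, MvPolynomial.X_pow_eq_monomial, MvPolynomial.monomial_mul,
    one_mul]

lemma add_eq_of_mem_support {P : MvPolynomial (Fin 2) K} {N : ℕ} (hP : P.IsHomogeneous N)
    {e : Fin 2 →₀ ℕ} (he : e ∈ P.support) : e 0 + e 1 = N := by
  rw [hP.degree_eq_sum_deg_support he, ← Fin.sum_univ_two]
  exact (Finset.sum_subset (Finset.subset_univ _) fun i _ hi =>
    Finsupp.notMem_support_iff.1 hi).symm

lemma range_binaryForm :
    LinearMap.range (binaryForm K n) = homogeneousSubmodule (Fin 2) K n := by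
  refine le_antisymm ?_ fun f hf => ?_
  · rw [binaryForm, Fintype.range_linearCombination, Submodule.span_le]
    rintro _ ⟨j, rfl⟩
    have h := (MvPolynomial.isHomogeneous_X_pow (R := K) (0 : Fin 2) (n - j : ℕ)).mul
      (MvPolynomial.isHomogeneous_X_pow (R := K) (1 : Fin 2) (j : ℕ))
    rwa [Nat.sub_add_cancel (Nat.le_of_lt_succ j.2)] at h
  · rw [f.as_sum]
    refine Submodule.sum_mem _ fun e he => ?_
    have hdeg := add_eq_of_mem_support hf he
    refine ⟨Pi.single ⟨e 1, by omega⟩ (coeff e f), ?_⟩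
    rw [binaryForm, Fintype.linearCombination_apply_single, X_pow_mul_X_pow,
      MvPolynomial.smul_monomial, smul_eq_mul, mul_one]
    have he' : Finsupp.single 0 (n - e 1) + Finsupp.single 1 (e 1) = e := by
      refine Finsupp.ext (Fin.forall_fin_two.2 ⟨?_, ?_⟩)
      · simp
        omega
      · simp
    rw [he']

lemma finrank_homogeneousSubmodule_fin_two_le :
    Module.finrank K (homogeneousSubmodule (Fin 2) K n) ≤ n + 1 := by
  rw [← range_binaryForm]
  exact (LinearMap.finrank_range_le _).trans (by simp)

lemma greedyMap_binaryForm_mul {u : ℕ → R}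
    (hu : ∀ i < n, ∀ j < n, u (i + 1) * u j = u i * u (j + 1)) (m : ℕ) (c : Fin (n + 1) → K)
    {P : MvPolynomial (Fin 2) K} (hP : P.IsHomogeneous (n * m)) :
    greedyMap K u n (m + 1) (binaryForm K n c * P) =
      Fintype.linearCombination K (fun j : Fin (n + 1) => u j) c * greedyMap K u n m P := by
  rw [binaryForm, Fintype.linearCombination_apply, Fintype.linearCombination_apply,
    Finset.sum_mul, Finset.sum_mul, map_sum]
  refine Finset.sum_congr rfl fun j _ => ?_
  rw [smul_mul_assoc, smul_mul_assoc, map_smul]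
  congr 1
  conv_lhs => rw [P.as_sum]
  conv_rhs => rw [P.as_sum]
  rw [Finset.mul_sum, map_sum, map_sum, Finset.mul_sum]
  refine Finset.sum_congr rfl fun e he => ?_
  have hdeg := add_eq_of_mem_support hP he
  rw [X_pow_mul_X_pow, MvPolynomial.monomial_mul, one_mul, greedyMap_monomial, greedyMap_monomial,
    mul_smul_comm, mul_greedyProd hu m (Nat.le_of_lt_succ j.2) (by omega)]
  simp

lemma greedyMap_aeval_binaryForm {σ : Type*} {u : ℕ → R}
    (hu : ∀ i < n, ∀ j < n, u (i + 1) * u j = u i * u (j + 1)) (c : σ → Fin (n + 1) → K) {m : ℕ}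
    {f : MvPolynomial σ K} (hf : f.IsHomogeneous m) :
    greedyMap K u n m (aeval (fun i => binaryForm K n (c i)) f) =
      aeval (fun i => Fintype.linearCombination K (fun j : Fin (n + 1) => u j) (c i)) f := by
  have hp : ∀ i, (binaryForm K n (c i)).IsHomogeneous n := fun i => by
    rw [← mem_homogeneousSubmodule, ← range_binaryForm]
    exact LinearMap.mem_range_self _ _
  have hf' : f ∈ homogeneousSubmodule σ K 1 ^ m := by
    rwa [homogeneousSubmodule_one_pow]
  clear hf
  induction hf' using Submodule.pow_induction_on_left' with
  | algebraMap r =>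
    rw [AlgHom.commutes, AlgHom.commutes, MvPolynomial.algebraMap_eq, ← MvPolynomial.monomial_zero',
      greedyMap_monomial, greedyProd, Algebra.algebraMap_eq_smul_one]
  | add x y i hx hy ihx ihy =>
    rw [map_add, map_add, map_add, ihx, ihy]
  | mem_mul l hl i x hx ih =>
    rw [homogeneousSubmodule_one_pow] at hx
    have hxp := hx.aeval _ hp
    rw [homogeneousSubmodule_one_eq_span_X] at hl
    rw [map_mul (aeval fun i => binaryForm K n (c i)), map_mul (aeval fun i => _), ← ih]
    induction hl using Submodule.span_induction with
    | mem y hy =>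
      obtain ⟨k, rfl⟩ := hy
      rw [aeval_X, aeval_X, greedyMap_binaryForm_mul hu i (c k) hxp]
    | zero => simp
    | add y z _ _ hy hz => rw [map_add, map_add, add_mul, add_mul, map_add, hy, hz]
    | smul a y _ hy => rw [map_smul, map_smul, smul_mul_assoc, smul_mul_assoc, map_smul, hy]

lemma aeval_aeval_eq_eval {σ τ : Type*} (p : σ → MvPolynomial τ K) (f : MvPolynomial σ K)
    (x : τ → K) : aeval x (aeval p f) = eval (fun i => eval x (p i)) f := by
  have h : ((MvPolynomial.aeval x : MvPolynomial τ K →ₐ[K] K).comp (aeval p)) =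
      aeval fun i => eval x (p i) := by
    ext i
    simp
  simpa using DFunLike.congr_fun h f

lemma aeval_eq_zero_of_forall_eval [Infinite K] {σ τ : Type*} {p : σ → MvPolynomial τ K}
    {f : MvPolynomial σ K} (hf : ∀ x : τ → K, eval (fun i => eval x (p i)) f = 0) :
    aeval p f = 0 :=
  MvPolynomial.funext fun x => by
    rw [map_zero, ← hf x, ← aeval_aeval_eq_eval, ← MvPolynomial.coe_aeval_eq_eval]
    rfl

lemma aeval_homogeneousComponent_eq_zero {σ τ : Type*} {p : σ → MvPolynomial τ K} (hn : n ≠ 0)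
    (hp : ∀ i, (p i).IsHomogeneous n) {f : MvPolynomial σ K} (hf : aeval p f = 0) (m : ℕ) :
    aeval p (homogeneousComponent m f) = 0 := by
  have hm : ∀ m, (aeval p (homogeneousComponent m f)).IsHomogeneous (n * m) := fun m =>
    (homogeneousComponent_isHomogeneous m f).aeval p hp
  have h : homogeneousComponent (n * m) (aeval p f) = aeval p (homogeneousComponent m f) := by
    conv_lhs => rw [← f.sum_homogeneousComponent, map_sum, map_sum]
    by_cases hmf : m ∈ Finset.range (f.totalDegree + 1)
    · rw [Finset.sum_eq_single_of_mem m hmf, homogeneousComponent_of_mem (hm m), if_pos rfl]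
      intro k _ hk
      rw [homogeneousComponent_of_mem (hm k), if_neg]
      simpa [hn] using hk.symm
    · rw [homogeneousComponent_eq_zero m f (by simpa using hmf), map_zero]
      refine Finset.sum_eq_zero fun k hk => ?_
      rw [homogeneousComponent_of_mem (hm k), if_neg]
      rintro h
      have := Nat.eq_of_mul_eq_mul_left (Nat.pos_of_ne_zero hn) h
      exact hmf (this ▸ hk)
  rw [← h, hf, map_zero]

lemma exists_isRNC_le [Infinite K] (hn : n ≠ 0) {I : Ideal (MvPolynomial (Fin (n + 1)) K)}
    (π : MvPolynomial (Fin (n + 1)) K →ₐ[K] R)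
    (hπ : ∀ m, ∀ f : MvPolynomial (Fin (n + 1)) K, f.IsHomogeneous m → π f = 0 → f ∈ I)
    {u : ℕ → R} (hu : ∀ i < n, ∀ j < n, u (i + 1) * u j = u i * u (j + 1))
    (hli : LinearIndependent K fun i : Fin (n + 1) => u i)
    (hspan : Submodule.span K (Set.range fun i : Fin (n + 1) => u i) =
      Submodule.span K (Set.range fun i => π (X i))) :
    ∃ C : Ideal (MvPolynomial (Fin (n + 1)) K), IsRNC n C ∧ C ≤ I := by
  set θ := Fintype.linearCombination K fun i : Fin (n + 1) => u i with hθ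
  have hθi : Function.Injective θ := hli.fintypeLinearCombination_injective
  have hc : ∀ i, ∃ c, θ c = π (X i) := fun i => by
    rw [← LinearMap.mem_range, hθ, Fintype.range_linearCombination, hspan]
    exact Submodule.subset_span ⟨i, rfl⟩
  choose c hc using hc
  have hp : ∀ i, (binaryForm K n (c i)).IsHomogeneous n := fun i => by
    rw [← mem_homogeneousSubmodule, ← range_binaryForm]
    exact LinearMap.mem_range_self _ _
  refine ⟨_, ⟨fun i => binaryForm K n (c i), hp, ?_, rfl⟩, fun f hf => ?_⟩
  · have hcs : Submodule.span K (Set.range c) = ⊤ := by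
      apply Submodule.map_injective_of_injective hθi
      rw [Submodule.map_span, ← Set.range_comp, Submodule.map_top, hθ,
        Fintype.range_linearCombination, hspan]
      congr 2
      exact funext hc
    rw [← range_binaryForm, ← Submodule.map_top, ← hcs, Submodule.map_span, ← Set.range_comp]
    rfl
  · have hf0 := aeval_eq_zero_of_forall_eval (p := fun i => binaryForm K n (c i)) (f := f)
      fun x => (Submodule.mem_iInf _).1 hf x
    rw [← f.sum_homogeneousComponent]
    refine Ideal.sum_mem _ fun m _ => hπ m _ (homogeneousComponent_isHomogeneous m f) ?_
    have h := greedyMap_aeval_binaryForm hu c (homogeneousComponent_isHomogeneous m f)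
    rw [aeval_homogeneousComponent_eq_zero hn hp hf0 m, map_zero, ← hθ] at h
    rw [h]
    simp_rw [hc]
    exact congrArg (fun g : MvPolynomial (Fin (n + 1)) K →ₐ[K] R => g (homogeneousComponent m f))
      (MvPolynomial.aeval_unique π)

lemma finrank_map_le_finrank_map {M M₁ M₂ : Type*} [AddCommGroup M] [Module K M] [AddCommGroup M₁]
    [Module K M₁] [AddCommGroup M₂] [Module K M₂] (S : Submodule K M) (f : M →ₗ[K] M₁)
    (g : M →ₗ[K] M₂) [FiniteDimensional K (S.map f)] (h : ∀ x ∈ S, f x = 0 → g x = 0) :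
    Module.finrank K (S.map g) ≤ Module.finrank K (S.map f) := by
  rw [← LinearMap.range_domRestrict S f, ← LinearMap.range_domRestrict S g]
  have hker : LinearMap.ker (f.domRestrict S) ≤ LinearMap.ker (g.domRestrict S) :=
    fun x hx => h x x.2 hx
  have : FiniteDimensional K (LinearMap.range (f.domRestrict S)) := by
    rwa [LinearMap.range_domRestrict]
  have := (f.domRestrict S).quotKerEquivRange.symm.finiteDimensional
  rw [← (f.domRestrict S).quotKerEquivRange.finrank_eq,
    ← Submodule.range_liftQ (LinearMap.ker (f.domRestrict S)) (g.domRestrict S) hker]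
  exact LinearMap.finrank_range_le _

lemma hilbF_le_of_isRNC_le {I C : Ideal (MvPolynomial (Fin (n + 1)) K)}
    (hC : IsRNC n C) (hCI : C ≤ I) (m : ℕ) : hilbF I m ≤ n * m + 1 := by
  obtain ⟨p, hp, -, rfl⟩ := hC
  have hfin : FiniteDimensional K (homogeneousSubmodule (Fin 2) K (n * m)) := by
    rw [← range_binaryForm]
    infer_instance
  have hle : (homogeneousSubmodule (Fin (n + 1)) K m).map (aeval p : MvPolynomial (Fin (n + 1)) K
      →ₐ[K] MvPolynomial (Fin 2) K).toLinearMap ≤ homogeneousSubmodule (Fin 2) K (n * m) := by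
    rintro _ ⟨f, hf, rfl⟩
    exact IsHomogeneous.aeval hf p hp
  have := Submodule.finiteDimensional_of_le hle
  refine le_trans ?_ ((Submodule.finrank_mono hle).trans finrank_homogeneousSubmodule_fin_two_le)
  refine finrank_map_le_finrank_map _ _ _ fun f _ hf => ?_
  refine Ideal.Quotient.eq_zero_iff_mem.2 (hCI ((Submodule.mem_iInf _).2 fun x => ?_))
  have h : (MvPolynomial.aeval x : MvPolynomial (Fin 2) K →ₐ[K] K) (aeval p f) = 0 := by
    rw [show aeval p f = 0 from hf, map_zero]
  rw [aeval_aeval_eq_eval] at h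
  exact h

end RationalNormalCurve

section CoordinateRing

variable {K : Type} [Field K] {n : ℕ} {I : Ideal (MvPolynomial (Fin (n + 1)) K)}

lemma mem_saturate {f : MvPolynomial (Fin (n + 1)) K} :
    f ∈ saturate I ↔ ∃ k : ℕ, ∀ g ∈ irrelevantIdeal K n ^ k, f * g ∈ I := by
  rw [saturate, Submodule.mem_iSup_of_directed]
  · simp only [Submodule.mem_colon, SetLike.mem_coe, smul_eq_mul]
  · exact Monotone.directed_le fun k l hkl =>
      Submodule.colon_mono le_rfl (Ideal.pow_le_pow_right hkl)

lemma le_irrelevantIdeal {f : MvPolynomial (Fin (n + 1)) K}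
    (hf : f ∈ homogeneousSubmodule (Fin (n + 1)) K 1) : f ∈ irrelevantIdeal K n := by
  rw [homogeneousSubmodule_one_eq_span_X] at hf
  exact Submodule.span_le_restrictScalars K _ _ hf

lemma exists_linearForm_regular [Infinite K] (hI : saturate I = I) :
    ∃ l ∈ homogeneousSubmodule (Fin (n + 1)) K 1, ∀ f, l * f ∈ I → f ∈ I := by
  by_contra! h
  set S := MvPolynomial (Fin (n + 1)) K
  set E := homogeneousSubmodule (Fin (n + 1)) K 1
  have hfin := associatedPrimes.finite S (S ⧸ I)
  have hE : (⊤ : Subspace K E) ∈ hfin.toFinset.image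
      fun P : Ideal S => (P.restrictScalars K).comap E.subtype := by
    refine Subspace.top_mem_of_biUnion_eq_univ (Set.eq_univ_of_forall fun l => ?_)
    obtain ⟨f, hf, hfI⟩ := h l l.2
    have hl : (l : S) ∈ ⋃ p ∈ associatedPrimes S (S ⧸ I), (p : Set S) := by
      rw [biUnion_associatedPrimes_eq_zero_divisors]
      refine ⟨Ideal.Quotient.mk I f, fun h => hfI (Ideal.Quotient.eq_zero_iff_mem.1 h), ?_⟩
      exact Ideal.Quotient.eq_zero_iff_mem.2 hf
    simp only [Set.mem_iUnion] at hl ⊢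
    obtain ⟨P, hP, hlP⟩ := hl
    exact ⟨_, Finset.mem_image_of_mem _ (hfin.mem_toFinset.2 hP), hlP⟩
  obtain ⟨P, hP, hPE⟩ := Finset.mem_image.1 hE
  obtain ⟨hPp, x, hx⟩ := isAssociatedPrime_iff.1 (hfin.mem_toFinset.1 hP)
  obtain ⟨f, rfl⟩ := Ideal.Quotient.mk_surjective x
  have hmem : ∀ g : S, g ∈ P ↔ g * f ∈ I := fun g => by
    rw [hx, Submodule.mem_colon_singleton, Submodule.mem_bot, ← Ideal.Quotient.eq_zero_iff_mem]
    rfl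
  refine hPp.ne_top ((Ideal.eq_top_iff_one P).2 ((hmem 1).2 ?_))
  rw [one_mul, ← hI, mem_saturate]
  refine ⟨1, fun g hg => ?_⟩
  rw [mul_comm, ← hmem]
  rw [pow_one] at hg
  refine (Ideal.span_le (I := P)).2 ?_ hg
  rintro _ ⟨i, rfl⟩
  have : (⟨X i, isHomogeneous_X K i⟩ : E) ∈ (P.restrictScalars K).comap E.subtype := by
    rw [hPE]
    trivial
  exact this

lemma aeval_mul_of_isHomogeneous {σ R : Type*} [CommRing R] [Algebra K R] (a : σ → R) (c : R)
    {m : ℕ} {f : MvPolynomial σ K} (hf : f.IsHomogeneous m) :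
    aeval (fun i => a i * c) f = aeval a f * c ^ m := by
  conv_lhs => rw [f.as_sum]
  conv_rhs => rw [f.as_sum]
  rw [map_sum, map_sum, Finset.sum_mul]
  refine Finset.sum_congr rfl fun e he => ?_
  rw [aeval_monomial, aeval_monomial, hf.degree_eq_sum_deg_support he, mul_assoc, Finsupp.prod,
    Finsupp.prod, ← Finset.prod_pow_eq_pow_sum, ← Finset.prod_mul_distrib]
  simp_rw [mul_pow]

lemma exists_dehomogenization {l : MvPolynomial (Fin (n + 1)) K}
    (hl : l ∈ homogeneousSubmodule (Fin (n + 1)) K 1) (hreg : ∀ f, l * f ∈ I → f ∈ I) :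
    ∃ (R : Type) (_ : CommRing R) (_ : Algebra K R) (π : MvPolynomial (Fin (n + 1)) K →ₐ[K] R),
      Function.Surjective π ∧ π l = 1 ∧
      ∀ m, ∀ f ∈ homogeneousSubmodule (Fin (n + 1)) K m, π f = 0 ↔ f ∈ I := by
  set A := MvPolynomial (Fin (n + 1)) K ⧸ I
  set s : A := Ideal.Quotient.mk I l with hs
  set L := Localization.Away s
  set c : L := IsLocalization.Away.invSelf s
  set φ : MvPolynomial (Fin (n + 1)) K →ₐ[K] L :=
    (IsScalarTower.toAlgHom K A L).comp (Ideal.Quotient.mkₐ K I) with hφ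
  have hφl : φ l * c = 1 := IsLocalization.Away.mul_invSelf s
  set π : MvPolynomial (Fin (n + 1)) K →ₐ[K] L := aeval fun i => φ (X i) * c with hπ
  have hπf : ∀ m, ∀ f ∈ homogeneousSubmodule (Fin (n + 1)) K m, π f = φ f * c ^ m := by
    intro m f hf
    rw [hπ, aeval_mul_of_isHomogeneous _ _ hf]
    congr 1
    exact congrArg (fun g : MvPolynomial (Fin (n + 1)) K →ₐ[K] L => g f)
      (MvPolynomial.aeval_unique φ).symm
  have hφI : ∀ f, φ f = 0 ↔ f ∈ I := by
    intro f
    rw [← Ideal.Quotient.eq_zero_iff_mem]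
    refine IsLocalization.map_eq_zero_iff (Submonoid.powers s) L _ |>.trans ?_
    constructor
    · rintro ⟨⟨_, k, rfl⟩, hk⟩
      have hk' : l ^ k * f ∈ I := by
        rw [← Ideal.Quotient.eq_zero_iff_mem, map_mul, map_pow]
        exact hk
      rw [Ideal.Quotient.eq_zero_iff_mem]
      clear hk
      induction k with
      | zero => simpa using hk'
      | succ k ih => exact ih (hreg _ (by rwa [← mul_assoc, ← pow_succ']))
    · exact fun h => ⟨1, by rw [OneMemClass.coe_one, one_mul]; exact h⟩
  refine ⟨π.range, inferInstance, inferInstance, π.rangeRestrict, π.rangeRestrict_surjective, ?_,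
    fun m f hf => ?_⟩
  · refine Subtype.ext ?_
    change π l = 1
    rw [hπf 1 l hl, pow_one, hφl]
  · rw [← hφI, ← ZeroMemClass.coe_eq_zero]
    change π f = 0 ↔ _
    rw [hπf m f hf]
    refine ⟨fun h => ?_, fun h => by rw [h, zero_mul]⟩
    have hu : IsUnit (c ^ m) := (IsUnit.of_mul_eq_one_right _ hφl).pow m
    exact hu.mul_left_eq_zero.1 h

lemma schemeDeg_eq_of_eventually {d : ℕ} (h : ∀ᶠ m in atTop, hilbF I m = d) : schemeDeg I = d := by
  have hex : ∃ d : ℕ, ∀ᶠ m : ℕ in atTop, hilbF I m = d := ⟨d, h⟩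
  rw [schemeDeg, dif_pos hex]
  obtain ⟨m, h₁, h₂⟩ := (hex.choose_spec.and h).exists
  exact h₁.symm.trans h₂

instance finiteDimensional_homogeneousSubmodule {σ : Type*} [Finite σ] (m : ℕ) :
    FiniteDimensional K (homogeneousSubmodule σ K m) :=
  Module.Finite.iff_fg.2 (homogeneousSubmodule_fg σ K m)

variable {R : Type} [CommRing R] [Algebra K R] {π : MvPolynomial (Fin (n + 1)) K →ₐ[K] R}

lemma finrank_map_pow (hI : ∀ m, ∀ f ∈ homogeneousSubmodule (Fin (n + 1)) K m, π f = 0 ↔ f ∈ I)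
    (m : ℕ) : Module.finrank K
      (((homogeneousSubmodule (Fin (n + 1)) K 1).map π.toLinearMap) ^ m : Submodule K R) =
      hilbF I m := by
  rw [← Submodule.map_pow, homogeneousSubmodule_one_pow, hilbF]
  refine le_antisymm (finrank_map_le_finrank_map _ _ _ fun f hf h => (hI m f hf).2 ?_)
    (finrank_map_le_finrank_map _ _ _ fun f hf h => ?_)
  · exact Ideal.Quotient.eq_zero_iff_mem.1 h
  · exact Ideal.Quotient.eq_zero_iff_mem.2 ((hI m f hf).1 h)

lemma exists_pow_eq_top (hπ : Function.Surjective π)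
    (hI : ∀ m, ∀ f ∈ homogeneousSubmodule (Fin (n + 1)) K m, π f = 0 ↔ f ∈ I)
    {l : MvPolynomial (Fin (n + 1)) K} (hl : l ∈ homogeneousSubmodule (Fin (n + 1)) K 1)
    (hπl : π l = 1) {d : ℕ} (hd : ∀ᶠ m in atTop, hilbF I m = d) :
    ∃ m₀, ∀ m ≥ m₀, (homogeneousSubmodule (Fin (n + 1)) K m).map π.toLinearMap = ⊤ := by
  set V := fun m => (homogeneousSubmodule (Fin (n + 1)) K m).map π.toLinearMap with hV
  have hmono : Monotone V := monotone_nat_of_le_succ fun m => by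
    rintro _ ⟨f, hf, rfl⟩
    refine ⟨f * l, IsHomogeneous.mul hf hl, ?_⟩
    change π (f * l) = π f
    rw [map_mul, hπl, mul_one]
  have hrank : ∀ m, Module.finrank K (V m) = hilbF I m := fun m => by
    rw [← finrank_map_pow hI, ← Submodule.map_pow, homogeneousSubmodule_one_pow]
  obtain ⟨m₀, hm₀⟩ := eventually_atTop.1 hd
  have hconst : ∀ m ≥ m₀, V m = V m₀ := fun m hm =>
    (Submodule.eq_of_le_of_finrank_eq (hmono hm)
      (by rw [hrank, hrank, hm₀ _ le_rfl, hm₀ _ hm])).symm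
  refine ⟨m₀, fun m hm => (hconst m hm).trans ((eq_top_iff).2 fun x _ => ?_)⟩
  obtain ⟨f, rfl⟩ := hπ x
  rw [← f.sum_homogeneousComponent, map_sum]
  refine Submodule.sum_mem _ fun k _ => ?_
  rw [← hconst (max k m₀) (le_max_right _ _)]
  exact hmono (le_max_left _ _) ⟨_, homogeneousComponent_isHomogeneous k f, rfl⟩

lemma le_ker_of_isHomogeneous (hhom : I.IsHomogeneous (homogeneousSubmodule (Fin (n + 1)) K))
    (hI : ∀ m, ∀ f ∈ homogeneousSubmodule (Fin (n + 1)) K m, π f = 0 ↔ f ∈ I) :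
    I ≤ RingHom.ker π := by
  intro f hf
  rw [RingHom.mem_ker, ← f.sum_homogeneousComponent, map_sum]
  refine Finset.sum_eq_zero fun m _ =>
    (hI m _ (homogeneousComponent_isHomogeneous m f)).2 ?_
  have := hhom m hf
  rwa [← MvPolynomial.decomposition.decompose'_apply]

lemma mem_saturate_sup_span_iff
    (hhom : I.IsHomogeneous (homogeneousSubmodule (Fin (n + 1)) K))
    (hI : ∀ m, ∀ f ∈ homogeneousSubmodule (Fin (n + 1)) K m, π f = 0 ↔ f ∈ I)
    {l : MvPolynomial (Fin (n + 1)) K} (hl : l ∈ homogeneousSubmodule (Fin (n + 1)) K 1)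
    (hπl : π l = 1) {W : Submodule K (MvPolynomial (Fin (n + 1)) K)}
    (hW : W ≤ homogeneousSubmodule (Fin (n + 1)) K 1) {m : ℕ}
    (hm : (homogeneousSubmodule (Fin (n + 1)) K m).map π.toLinearMap = ⊤)
    {f : MvPolynomial (Fin (n + 1)) K} (hf : f ∈ homogeneousSubmodule (Fin (n + 1)) K (m + 1)) :
    f ∈ saturate (I ⊔ Ideal.span (W : Set (MvPolynomial (Fin (n + 1)) K))) ↔
      π f ∈ Ideal.span (W.map π.toLinearMap : Set R) := by
  rw [mem_saturate]
  constructor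
  · rintro ⟨k, hk⟩
    have hle : I ⊔ Ideal.span (W : Set (MvPolynomial (Fin (n + 1)) K)) ≤
        (Ideal.span (W.map π.toLinearMap : Set R)).comap π := by
      refine sup_le ((le_ker_of_isHomogeneous hhom hI).trans (Ideal.comap_mono bot_le)) ?_
      exact Ideal.span_le.2 fun w hw => Ideal.subset_span ⟨w, hw, rfl⟩
    have := hle (hk (l ^ k) (Ideal.pow_mem_pow (le_irrelevantIdeal hl) k))
    rwa [Ideal.mem_comap, map_mul, map_pow, hπl, one_pow, mul_one] at this
  · intro h
    have key : ∀ x ∈ Ideal.span (W.map π.toLinearMap : Set R),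
        ∃ g ∈ homogeneousSubmodule (Fin (n + 1)) K (m + 1),
          g ∈ Ideal.span (W : Set (MvPolynomial (Fin (n + 1)) K)) ∧ π g = x := by
      intro x hx
      induction hx using Submodule.closure_induction with
      | zero => exact ⟨0, Submodule.zero_mem _, Submodule.zero_mem _, map_zero π⟩
      | add x y _ _ hx hy =>
        obtain ⟨g, hg, hgW, rfl⟩ := hx
        obtain ⟨g', hg', hgW', rfl⟩ := hy
        exact ⟨g + g', add_mem hg hg', add_mem hgW hgW', map_add π g g'⟩
      | smul_mem r x hx =>
        obtain ⟨w, hw, rfl⟩ := hx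
        obtain ⟨g, hg, rfl⟩ : r ∈ (homogeneousSubmodule (Fin (n + 1)) K m).map π.toLinearMap := by
          rw [hm]
          trivial
        exact ⟨g * w, IsHomogeneous.mul hg (hW hw), Ideal.mul_mem_left _ _ (Ideal.subset_span hw),
          map_mul π g w⟩
    obtain ⟨g, hg, hgW, hgf⟩ := key _ h
    have hfg : f ∈ I ⊔ Ideal.span (W : Set (MvPolynomial (Fin (n + 1)) K)) := by
      rw [← sub_add_cancel f g]
      refine add_mem (Ideal.mem_sup_left ((hI (m + 1) _ (sub_mem hf hg)).1 ?_))
        (Ideal.mem_sup_right hgW)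
      rw [map_sub, hgf, sub_self]
    exact ⟨0, fun g _ => Ideal.mul_mem_right _ _ hfg⟩

lemma schemeDeg_interIdeal_add [FiniteDimensional K R]
    (hhom : I.IsHomogeneous (homogeneousSubmodule (Fin (n + 1)) K))
    (hI : ∀ m, ∀ f ∈ homogeneousSubmodule (Fin (n + 1)) K m, π f = 0 ↔ f ∈ I)
    {l : MvPolynomial (Fin (n + 1)) K} (hl : l ∈ homogeneousSubmodule (Fin (n + 1)) K 1)
    (hπl : π l = 1) {W : Submodule K (MvPolynomial (Fin (n + 1)) K)}
    (hW : W ≤ homogeneousSubmodule (Fin (n + 1)) K 1) {m₀ : ℕ}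
    (hm₀ : ∀ m ≥ m₀, (homogeneousSubmodule (Fin (n + 1)) K m).map π.toLinearMap = ⊤) :
    schemeDeg (interIdeal I (Ideal.span (W : Set (MvPolynomial (Fin (n + 1)) K)))) +
      idealDim K (Ideal.span (W.map π.toLinearMap : Set R)) = Module.finrank K R := by
  set b := Ideal.span (W.map π.toLinearMap : Set R)
  have hdeg : schemeDeg (interIdeal I (Ideal.span (W : Set (MvPolynomial (Fin (n + 1)) K)))) =
      Module.finrank K (R ⧸ b.restrictScalars K) := by
    refine schemeDeg_eq_of_eventually (eventually_atTop.2 ⟨m₀ + 1, fun m hm => ?_⟩)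
    obtain ⟨m, rfl⟩ := Nat.exists_eq_add_of_le' (Nat.one_le_of_lt hm)
    have hm' := hm₀ m (by omega)
    have hrange : (homogeneousSubmodule (Fin (n + 1)) K (m + 1)).map
        ((b.restrictScalars K).mkQ ∘ₗ π.toLinearMap) = ⊤ := by
      rw [Submodule.map_comp, hm₀ _ (by omega), Submodule.map_top, Submodule.range_mkQ]
    rw [← finrank_top K (R ⧸ b.restrictScalars K), ← hrange, hilbF]
    have hiff := fun f (hf : f ∈ homogeneousSubmodule (Fin (n + 1)) K (m + 1)) =>
      mem_saturate_sup_span_iff hhom hI hl hπl hW hm' hf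
    refine le_antisymm (finrank_map_le_finrank_map _ _ _ fun f hf h => ?_)
      (finrank_map_le_finrank_map _ _ _ fun f hf h => ?_)
    · exact Ideal.Quotient.eq_zero_iff_mem.2
        ((hiff f hf).2 ((Submodule.Quotient.mk_eq_zero (b.restrictScalars K)).1 h))
    · exact (Submodule.Quotient.mk_eq_zero (b.restrictScalars K)).2
        ((hiff f hf).1 (Ideal.Quotient.eq_zero_iff_mem.1 h))
  rw [hdeg, idealDim]
  exact Submodule.finrank_quotient_add_finrank _

lemma finrank_homogeneousSubmodule_one :
    Module.finrank K (homogeneousSubmodule (Fin (n + 1)) K 1) = n + 1 := by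
  rw [homogeneousSubmodule_one_eq_span_X, finrank_span_eq_card (linearIndependent_X _ _),
    Fintype.card_fin]

lemma schemeDeg_interIdeal_le (hlgp : InLinGenPos I)
    {W : Submodule K (MvPolynomial (Fin (n + 1)) K)}
    (hW : W ≤ homogeneousSubmodule (Fin (n + 1)) K 1) (hW₀ : W ≠ ⊥) (hWn : Module.finrank K W ≤ n) :
    schemeDeg (interIdeal I (Ideal.span (W : Set (MvPolynomial (Fin (n + 1)) K)))) +
      Module.finrank K W ≤ n + 1 := by
  have := Submodule.finiteDimensional_of_le hW
  have hpos : 0 < Module.finrank K W :=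
    Nat.pos_of_ne_zero fun h => hW₀ (Submodule.finrank_eq_zero.1 h)
  have ht : n - Module.finrank K W < sInf {t : ℕ | HasSecantPlane I t} := by
    rw [InLinGenPos, tInv] at hlgp
    rw [hlgp]
    omega
  by_contra! h
  exact Nat.notMem_of_lt_sInf ht ⟨_, ⟨W, hW, by omega, rfl⟩, by omega⟩

lemma eq_zero_of_inLinGenPos [FiniteDimensional K R] (hlgp : InLinGenPos I) (hn : 1 ≤ n)
    (hhom : I.IsHomogeneous (homogeneousSubmodule (Fin (n + 1)) K))
    (hI : ∀ m, ∀ f ∈ homogeneousSubmodule (Fin (n + 1)) K m, π f = 0 ↔ f ∈ I)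
    {l : MvPolynomial (Fin (n + 1)) K} (hl : l ∈ homogeneousSubmodule (Fin (n + 1)) K 1)
    (hπl : π l = 1) {m₀ : ℕ}
    (hm₀ : ∀ m ≥ m₀, (homogeneousSubmodule (Fin (n + 1)) K m).map π.toLinearMap = ⊤)
    (hd : n < Module.finrank K R) {f : MvPolynomial (Fin (n + 1)) K}
    (hf : f ∈ homogeneousSubmodule (Fin (n + 1)) K 1) (hπf : π f = 0) : f = 0 := by
  by_contra hf₀
  have hW : Submodule.span K {f} ≤ homogeneousSubmodule (Fin (n + 1)) K 1 := by
    simpa using hf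
  have h₁ := finrank_span_singleton (K := K) hf₀
  have h₂ := schemeDeg_interIdeal_le hlgp hW (by simpa using hf₀) (by omega)
  have h₃ := schemeDeg_interIdeal_add hhom hI hl hπl hW hm₀
  have hmap : (Submodule.span K {f}).map π.toLinearMap = ⊥ := by
    rw [Submodule.map_span, Set.image_singleton, AlgHom.toLinearMap_apply, hπf]
    simp
  rw [hmap, Submodule.bot_coe, Ideal.span_singleton_zero, idealDim_bot] at h₃
  omega

lemma linearlyGeneral_map [FiniteDimensional K R] (hlgp : InLinGenPos I) (hn : 1 ≤ n)
    (hhom : I.IsHomogeneous (homogeneousSubmodule (Fin (n + 1)) K))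
    (hI : ∀ m, ∀ f ∈ homogeneousSubmodule (Fin (n + 1)) K m, π f = 0 ↔ f ∈ I)
    {l : MvPolynomial (Fin (n + 1)) K} (hl : l ∈ homogeneousSubmodule (Fin (n + 1)) K 1)
    (hπl : π l = 1) {m₀ : ℕ}
    (hm₀ : ∀ m ≥ m₀, (homogeneousSubmodule (Fin (n + 1)) K m).map π.toLinearMap = ⊤)
    (hd : n < Module.finrank K R) :
    LinearlyGeneral ((homogeneousSubmodule (Fin (n + 1)) K 1).map π.toLinearMap) n := by
  set E := homogeneousSubmodule (Fin (n + 1)) K 1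
  have hinj : ∀ U ≤ E, Module.finrank K (U.map π.toLinearMap) = Module.finrank K U := by
    intro U hU
    have := Submodule.finiteDimensional_of_le hU
    refine le_antisymm (Submodule.finrank_map_le _ _) ?_
    have h := finrank_map_le_finrank_map U π.toLinearMap LinearMap.id fun f hf hπf =>
      eq_zero_of_inLinGenPos hlgp hn hhom hI hl hπl hm₀ hd (hU hf) hπf
    rwa [Submodule.map_id] at h
  have hE : Module.finrank K (E.map π.toLinearMap) = n + 1 :=
    (hinj E le_rfl).trans finrank_homogeneousSubmodule_one
  have hone : (1 : R) ∈ E.map π.toLinearMap := ⟨l, hl, hπl⟩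
  refine ⟨hone, hE, fun W hW hW₀ => ?_⟩
  by_cases hWn : Module.finrank K W ≤ n
  · obtain ⟨U, hUE, hUW⟩ : ∃ U ≤ E, U.map π.toLinearMap = W :=
      ⟨E ⊓ W.comap π.toLinearMap, inf_le_left, by
        rw [← Submodule.map_inf_eq_map_inf_comap, inf_eq_right.2 hW]⟩
    have hUr := hinj U hUE
    rw [hUW] at hUr
    have hU₀ : U ≠ ⊥ := by
      intro h
      rw [h, Submodule.map_bot] at hUW
      exact hW₀ hUW.symm
    have h₁ := schemeDeg_interIdeal_le hlgp hUE hU₀ (by omega)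
    have h₂ := schemeDeg_interIdeal_add hhom hI hl hπl hUE hm₀
    rw [hUW] at h₂
    omega
  · have hWE : W = E.map π.toLinearMap :=
      Submodule.eq_of_le_of_finrank_le hW (by omega)
    have htop : Ideal.span (W : Set R) = ⊤ :=
      (Ideal.eq_top_iff_one _).2 (Ideal.subset_span (hWE ▸ hone))
    rw [htop, idealDim_top, hWE, hE]

end CoordinateRing

/-- Theorem 5.5, the first equivalence. -/
theorem stmt17 (K : Type) [Field K] [IsAlgClosed K] [CharZero K] (n d q r : ℕ) (hn : 2 ≤ n)
    (I : Ideal (MvPolynomial (Fin (n+1)) K))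
    (hfin : IsFiniteSubscheme I) (hlgp : InLinGenPos I) (hdeg : schemeDeg I = d)
    (hd : 4*n^2 + 6*n + 1 ≤ d)
    (hdqr : d = n*q + r + 2) (hr : r ≤ n - 1) :
    (∃ C : Ideal (MvPolynomial (Fin (n+1)) K), IsRNC n C ∧ C ≤ I) ↔ h1F I q = r + 1 := by
  obtain ⟨l, hl, hreg⟩ := exists_linearForm_regular hfin.saturated
  obtain ⟨R, _, _, π, hπ, hπl, hI⟩ := exists_dehomogenization hl hreg
  obtain ⟨d', -, hd'⟩ := hfin.finite
  obtain rfl : d' = d := (schemeDeg_eq_of_eventually hd').symm.trans hdeg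
  obtain ⟨m₀, hm₀⟩ := exists_pow_eq_top hπ hI hl hπl hd'
  have : FiniteDimensional K R := by
    have h : FiniteDimensional K ((homogeneousSubmodule (Fin (n + 1)) K m₀).map π.toLinearMap) :=
      inferInstance
    rw [hm₀ m₀ le_rfl] at h
    exact Module.Finite.of_surjective (⊤ : Submodule K R).subtype fun x => ⟨⟨x, trivial⟩, rfl⟩
  have hR : Module.finrank K R = d' := by
    obtain ⟨m, hm, hmd⟩ := ((eventually_ge_atTop m₀).and hd').exists
    rw [← hmd, ← finrank_map_pow hI, ← Submodule.map_pow, homogeneousSubmodule_one_pow, hm₀ m hm,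
      finrank_top]
  have hle : hilbF I q ≤ d' := by
    rw [← finrank_map_pow hI, ← hR]
    exact Submodule.finrank_le _
  have hV := linearlyGeneral_map hlgp (by omega) hfin.homog hI hl hπl hm₀ (by omega)
  have hq : 3 ≤ q := by
    by_contra! h
    have : n * q ≤ n * 2 := Nat.mul_le_mul_left n (by omega)
    omega
  have hiff : h1F I q = r + 1 ↔ hilbF I q = n * q + 1 := by
    rw [h1F, hdeg]
    omega
  rw [hiff]
  constructor
  · rintro ⟨C, hC, hCI⟩
    refine le_antisymm (hilbF_le_of_isRNC_le hC hCI q) ?_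
    rw [← finrank_map_pow hI]
    exact hV.le_finrank_pow (by omega)
  · intro h
    rw [← finrank_map_pow hI] at h
    obtain ⟨u, hli, hspan, hu⟩ := hV.exists_basis (by omega) hq h (by omega)
    refine exists_isRNC_le (by omega) π (fun m f hf => (hI m f hf).1) hu hli ?_
    rw [hspan, homogeneousSubmodule_one_eq_span_X, Submodule.map_span, ← Set.range_comp]
    rfl
end
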